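/- arXiv:2506.17575 — 2 statements merged into one kernel-verified Lean document; each statement's English description precedes it below -/
import Mathlib

section
/- Let 4/3 < α < 2 and T > 0, and let λ : ℕ → ℝ be a nondecreasing sequence of positive numbers with λ_n → ∞ such that E_{α,2}(−λ_n T^α) ≠ 0 for every n. Then there exists a constant C_T > 0 (depending on α, T and the sequence λ) such that for every n, C_T^{-1} / (1 + λ_n T^α) ≤ |E_{α,2}(−λ_n T^α)| ≤ C_T / (1 + λ_n T^α). -/
/-- The two-parameter Mittag-Leffler function `E_{α,β}(t) = ∑_{k=0}^∞ t^k / Γ(α k + β)`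
on the real line, with `Γ` the real Gamma function. -/
noncomputable def mittagLeffler (α β t : ℝ) : ℝ :=
  ∑' k : ℕ, t ^ k / Real.Gamma (α * k + β)

open MeasureTheory Filter Topology Set

theorem ml_integrable_aux (a e : ℝ) (ha : 0 < a) (he : 0 < e) :
    IntegrableOn (fun t : ℝ => t ^ (a - 1) * Real.exp (-(e * t))) (Ioi 0) := by
  have := integrableOn_rpow_mul_exp_neg_mul_rpow (s := a - 1) (p := 1) (b := e) (by linarith) (by norm_num) he
  simpa using this

theorem ml_meas_aux (a : ℝ) (r : ℂ) :
    AEStronglyMeasurable (fun t : ℝ => ((t ^ (a - 1) : ℝ) : ℂ) * Complex.exp (-(r * t)))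
      (volume.restrict (Ioi 0)) := by
  apply Measurable.aestronglyMeasurable
  fun_prop

theorem ml_integrable_aux' (a : ℝ) (r : ℂ) (ha : 0 < a) (he : 0 < r.re) :
    IntegrableOn (fun t : ℝ => ((t ^ (a - 1) : ℝ) : ℂ) * Complex.exp (-(r * t))) (Ioi 0) := by
  refine Integrable.mono' (ml_integrable_aux a r.re ha he) (ml_meas_aux a r) ?_
  filter_upwards [ae_restrict_mem measurableSet_Ioi] with t ht
  rw [norm_mul, Complex.norm_exp, Complex.norm_real, Real.norm_of_nonneg (Real.rpow_nonneg (le_of_lt ht) _)]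
  simp

theorem ml_laplace (a : ℝ) (ha : 0 < a) (r : ℂ) (hr : 0 < r.re) :
    ∫ t : ℝ in Ioi 0, ((t ^ (a - 1) : ℝ) : ℂ) * Complex.exp (-(r * t)) =
      r ^ (-(a:ℂ)) * Real.Gamma a := by
  have hopen : IsOpen {z : ℂ | 0 < z.re} := isOpen_lt continuous_const Complex.continuous_re
  have hd : DifferentiableOn ℂ (fun r : ℂ => ∫ t : ℝ in Ioi 0, ((t ^ (a - 1) : ℝ) : ℂ) *
      Complex.exp (-(r * t))) {z : ℂ | 0 < z.re} := by
    intro r hr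
    have hr : 0 < r.re := hr
    apply DifferentiableAt.differentiableWithinAt
    have hs : {z : ℂ | r.re / 2 < z.re} ∈ 𝓝 r :=
      (isOpen_lt continuous_const Complex.continuous_re).mem_nhds (by simp; linarith)
    refine (hasDerivAt_integral_of_dominated_loc_of_deriv_le (𝕜 := ℂ) 
      (F := fun (r : ℂ) (t : ℝ) => ((t ^ (a - 1) : ℝ) : ℂ) * Complex.exp (-(r * t)))
      (F' := fun (r : ℂ) (t : ℝ) => ((t ^ (a - 1) : ℝ) : ℂ) * (Complex.exp (-(r * t)) * (-t)))
      (bound := fun t : ℝ => t ^ (a + 1 - 1) * Real.exp (-(r.re / 2 * t)))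
      hs ?_ (ml_integrable_aux' a r ha hr) ?_ ?_ (ml_integrable_aux (a+1) (r.re/2) (by linarith) (by linarith)) ?_).2.differentiableAt
    · exact Eventually.of_forall fun x => ml_meas_aux a x
    · apply Measurable.aestronglyMeasurable
      fun_prop
    · filter_upwards [ae_restrict_mem measurableSet_Ioi] with t ht x hx
      have ht : 0 < t := ht
      have hx : r.re / 2 < x.re := hx
      rw [norm_mul, norm_mul, Complex.norm_exp, Complex.norm_real,
        Real.norm_of_nonneg (Real.rpow_nonneg (le_of_lt ht) _), norm_neg, Complex.norm_real,
        Real.norm_of_nonneg ht.le]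
      have : t ^ (a + 1 - 1) = t ^ (a - 1) * t := by
        rw [← Real.rpow_add_one ht.ne']; congr 1; ring
      rw [this, mul_assoc, mul_comm t]
      have h0 := Real.rpow_nonneg ht.le (a - 1)
      gcongr
      simp
      gcongr
    · filter_upwards with t x hx
      apply HasDerivAt.const_mul
      apply HasDerivAt.cexp
      simpa using ((hasDerivAt_id x).mul_const (t:ℂ)).fun_neg
  have hd2 : DifferentiableOn ℂ (fun r : ℂ => r ^ (-(a:ℂ)) * Real.Gamma a) {z : ℂ | 0 < z.re} := by
    intro r hr
    apply DifferentiableAt.differentiableWithinAt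
    apply DifferentiableAt.mul_const
    exact (differentiableAt_id).cpow_const (Or.inl hr)
  refine (hd.analyticOnNhd hopen).eqOn_of_preconnected_of_frequently_eq (hd2.analyticOnNhd hopen)
    (convex_halfSpace_re_gt 0).isPreconnected (z₀ := 1) (by simp) ?_ hr
  have ht : Tendsto (fun x : ℝ => (x : ℂ)) (𝓝[>] 1) (𝓝[≠] 1) := by
    refine tendsto_nhdsWithin_iff.2 ⟨?_, ?_⟩
    · exact (Complex.continuous_ofReal.tendsto' 1 1 (by simp)).mono_left nhdsWithin_le_nhds
    · filter_upwards [self_mem_nhdsWithin] with x hx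
      have : (1:ℝ) < x := hx
      simp; exact_mod_cast this.ne'
  refine ht.frequently (Eventually.frequently ?_)
  filter_upwards [self_mem_nhdsWithin] with x hx
  have hx : (1:ℝ) < x := hx
  have := Complex.integral_cpow_mul_exp_neg_mul_Ioi (a := a) (r := x) (by simpa) (by linarith)
  rw [Complex.Gamma_ofReal] at this
  convert this using 1
  · apply setIntegral_congr_fun measurableSet_Ioi
    intro t ht
    simp only
    rw [Complex.ofReal_cpow (le_of_lt ht)]
    simp
  · rw [one_div, Complex.inv_cpow, Complex.cpow_neg]
    rw [Complex.arg_ofReal_of_nonneg (by linarith)]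
    exact Real.pi_pos.ne

noncomputable def mlS (ξ : ℝ) : ℂ := 1 + 2 * Real.pi * ξ * Complex.I

theorem mlS_re (ξ : ℝ) : (mlS ξ).re = 1 := by simp [mlS]
theorem mlS_ne (ξ : ℝ) : mlS ξ ≠ 0 := by
  intro h; have := mlS_re ξ; rw [h] at this; simp at this
theorem mlS_norm (ξ : ℝ) : 1 ≤ ‖mlS ξ‖ := by
  have := Complex.re_le_norm (mlS ξ); rwa [mlS_re] at this
theorem mlS_cont : Continuous mlS := by unfold mlS; fun_prop
theorem mlS_cpow_cont (w : ℂ) : Continuous (fun ξ => mlS ξ ^ w) := by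
  refine mlS_cont.cpow continuous_const fun ξ => Or.inl (by rw [mlS_re]; norm_num)

theorem mlS_int (p : ℝ) (hp : 1 < p) : Integrable (fun ξ => ‖mlS ξ‖ ^ (-p)) := by
  have h := integrable_rpow_neg_one_add_norm_sq (E := ℝ) (μ := volume) (r := p) (by simpa)
  refine h.mono' ?_ ?_
  · refine Continuous.aestronglyMeasurable ?_
    refine mlS_cont.norm.rpow_const fun ξ => Or.inl ?_
    have := mlS_norm ξ
    positivity
  · filter_upwards with ξ
    have h1 := mlS_norm ξ
    rw [Real.norm_of_nonneg (by positivity)]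
    have h2 : (1 + ‖ξ‖^2) ≤ ‖mlS ξ‖^2 := by
      rw [← Complex.normSq_eq_norm_sq, Complex.normSq_apply]
      simp [mlS]
      have := Real.pi_gt_three
      nlinarith [sq_nonneg ξ, mul_nonneg (sq_nonneg ξ) (by nlinarith : 0 ≤ (2*Real.pi)^2 - 1)]
    have h3 : ‖mlS ξ‖ ^ (-p) = (‖mlS ξ‖^2) ^ (-p/2) := by
      rw [← Real.rpow_natCast, ← Real.rpow_mul (by positivity)]
      congr 1; push_cast; ring
    rw [h3]
    exact Real.rpow_le_rpow_of_nonpos (by positivity) h2 (by linarith)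

theorem mlS_int' (p : ℝ) (hp : 1 < p) : Integrable (fun ξ => mlS ξ ^ (-(p:ℂ))) := by
  refine (mlS_int p hp).mono' (mlS_cpow_cont _).aestronglyMeasurable ?_
  filter_upwards with ξ
  rw [← Complex.ofReal_neg, Complex.norm_cpow_real]

theorem ml_invGamma (w : ℝ) (hw : 1 < w) :
    ∫ ξ : ℝ, Complex.exp (mlS ξ) * mlS ξ ^ (-(w:ℂ)) = ((Real.Gamma w)⁻¹ : ℝ) := by
  set g : ℝ → ℂ := (Ioi 0).indicator (fun t : ℝ => ((t ^ (w - 1) : ℝ) : ℂ) * Complex.exp (-((1:ℂ) * t))) with hg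
  have hgi : Integrable g := by
    rw [hg, integrable_indicator_iff measurableSet_Ioi]
    exact ml_integrable_aux' w 1 (by linarith) (by simp)
  have hF : FourierTransform.fourier g = fun ξ => mlS ξ ^ (-(w:ℂ)) * Real.Gamma w := by
    ext ξ
    rw [Real.fourier_real_eq_integral_exp_smul, ← ml_laplace w (by linarith) (mlS ξ) (by rw [mlS_re]; norm_num),
      ← integral_indicator measurableSet_Ioi]
    congr 1 with t
    by_cases ht : t ∈ Ioi (0:ℝ)
    · simp only [hg, indicator_of_mem ht, smul_eq_mul]
      rw [mul_left_comm, ← Complex.exp_add]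
      congr 2
      simp [mlS]; ring
    · simp only [hg, indicator_of_notMem ht, smul_zero]
  have hinv := hgi.fourierInv_fourier_eq (by rw [hF]; exact (mlS_int' w hw).mul_const _) (v := 1) (by
    have : g =ᶠ[𝓝 1] (fun t : ℝ => ((t ^ (w - 1) : ℝ) : ℂ) * Complex.exp (-((1:ℂ) * t))) := by
      filter_upwards [Ioi_mem_nhds (by norm_num : (0:ℝ) < 1)] with t ht
      simp only [hg, indicator_of_mem ht]
    refine ContinuousAt.congr ?_ this.symm
    refine ContinuousAt.mul ?_ (by fun_prop)
    exact Complex.continuous_ofReal.continuousAt.comp (Real.continuousAt_rpow_const _ _ (Or.inl one_ne_zero)))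
  rw [hF, Real.fourierInv_eq'] at hinv
  have h1 : g 1 = Complex.exp (-1) := by
    simp [hg]
  rw [h1] at hinv
  have hG : (Real.Gamma w : ℂ) ≠ 0 := by exact_mod_cast (Real.Gamma_pos_of_pos (by linarith)).ne'
  have h2 : ∫ ξ : ℝ, Complex.exp (mlS ξ) * mlS ξ ^ (-(w:ℂ)) = Complex.exp 1 * (Real.Gamma w : ℂ)⁻¹ * Complex.exp (-1) := by
    rw [← hinv, ← integral_const_mul]
    congr 1 with ξ
    have : Complex.exp (mlS ξ) = Complex.exp 1 * Complex.exp (((2 * Real.pi * inner ℝ ξ 1 : ℝ) : ℂ) * Complex.I) := by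
      rw [← Complex.exp_add]; congr 1; simp [mlS]
    rw [this, smul_eq_mul]
    field_simp
  rw [h2, mul_right_comm, ← Complex.exp_add]
  simp

noncomputable def mlQ (α ξ : ℝ) : ℂ := mlS ξ ^ (-(α:ℂ))
noncomputable def mlK (ξ : ℝ) : ℂ := Complex.exp (mlS ξ) * mlS ξ ^ (-((3:ℝ):ℂ))
noncomputable def mlH (α : ℝ) (z : ℂ) (ξ : ℝ) : ℂ :=
  mlK ξ * ((2 - α) / (1 - z * mlQ α ξ) + α / (1 - z * mlQ α ξ) ^ 2)

theorem mlQ_norm (α ξ : ℝ) : ‖mlQ α ξ‖ = ‖mlS ξ‖ ^ (-α) := by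
  rw [mlQ, ← Complex.ofReal_neg, Complex.norm_cpow_real]

theorem mlQ_norm_le (α ξ : ℝ) (h : 0 < α) : ‖mlQ α ξ‖ ≤ 1 := by
  rw [mlQ_norm]
  exact Real.rpow_le_one_of_one_le_of_nonpos (mlS_norm ξ) (by linarith)

theorem mlQ_ne (α ξ : ℝ) : mlQ α ξ ≠ 0 := by
  rw [mlQ, Complex.cpow_ne_zero_iff]; exact Or.inl (mlS_ne ξ)

theorem mlQ_cont (α : ℝ) : Continuous (mlQ α) := mlS_cpow_cont _

theorem mlK_norm (ξ : ℝ) : ‖mlK ξ‖ = Real.exp 1 * ‖mlS ξ‖ ^ (-3:ℝ) := by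
  rw [mlK, norm_mul, Complex.norm_exp, mlS_re, ← Complex.ofReal_neg, Complex.norm_cpow_real]

theorem mlK_cont : Continuous mlK := mlS_cont.cexp.mul (mlS_cpow_cont _)

theorem mlK_int : Integrable mlK := by
  refine ((mlS_int 3 (by norm_num)).const_mul (Real.exp 1)).mono' mlK_cont.aestronglyMeasurable ?_
  filter_upwards with ξ
  rw [mlK_norm]

theorem mlQ_lower (α : ℝ) (h1 : 1 < α) (h2 : α < 2) :
    ∃ c : ℝ, 0 < c ∧ c ≤ 1 ∧ ∀ x : ℝ, 0 ≤ x → ∀ ξ, c ≤ ‖1 + x * mlQ α ξ‖ := by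
  have hpi := Real.pi_pos
  refine ⟨Real.sin (Real.pi * α / 2), Real.sin_pos_of_pos_of_lt_pi (by positivity) (by nlinarith),
    Real.sin_le_one _, fun x hx ξ => ?_⟩
  set θ := -α * (mlS ξ).arg with hθ
  set ρ := ‖mlS ξ‖ ^ (-α) with hρ
  have hρ0 : 0 ≤ ρ := by positivity
  have harg : |(mlS ξ).arg| < Real.pi / 2 :=
    Complex.abs_arg_lt_pi_div_two_iff.2 (Or.inl (by rw [mlS_re]; norm_num))
  have hq : mlQ α ξ = ρ * Complex.exp (θ * Complex.I) := by
    rw [mlQ, ← Complex.ofReal_neg, Complex.cpow_def_of_ne_zero (mlS_ne ξ), hρ,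
      Real.rpow_def_of_pos (by have := mlS_norm ξ; linarith), Complex.ofReal_exp, ← Complex.exp_add]
    congr 1
    rw [Complex.log, hθ]; push_cast; ring
  have hcos : Real.cos (Real.pi * α / 2) ≤ Real.cos θ := by
    rw [← Real.cos_abs θ]
    apply Real.cos_le_cos_of_nonneg_of_le_pi (abs_nonneg _) (by nlinarith)
    rw [hθ, abs_mul, abs_neg, abs_of_pos (by linarith : 0 < α)]
    nlinarith
  apply (fun h h' => (le_abs_self _).trans (abs_le_of_sq_le_sq h h') : ∀ {a b : ℝ}, a ^ 2 ≤ b ^ 2 → 0 ≤ b → a ≤ b) ?_ (norm_nonneg _)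
  rw [← Complex.normSq_eq_norm_sq, Complex.normSq_apply, hq, Complex.exp_mul_I]
  simp [← Complex.ofReal_cos, ← Complex.ofReal_sin]
  have hc := Real.sin_sq_add_cos_sq θ
  have hc2 := Real.sin_sq_add_cos_sq (Real.pi * α / 2)
  have e : (1 + x * (ρ * Real.cos θ)) * (1 + x * (ρ * Real.cos θ)) + x * (ρ * Real.sin θ) * (x * (ρ * Real.sin θ))
    = 1 + 2 * (x * ρ) * Real.cos θ + (x*ρ)^2 := by
    linear_combination (x*ρ)^2 * hc
  rw [e]
  have : 0 ≤ x * ρ := by positivity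
  nlinarith [sq_nonneg (x * ρ + Real.cos (Real.pi * α / 2)), mul_le_mul_of_nonneg_left hcos this]

noncomputable def mlE (α : ℝ) (z : ℂ) : ℂ := ∑' k : ℕ, z ^ k / (Real.Gamma (α * k + 2) : ℂ)

theorem mlE_diff (α : ℝ) (h1 : 1 < α) : Differentiable ℂ (mlE α) := by
  intro z
  have : DifferentiableOn ℂ (mlE α) (Metric.ball 0 (‖z‖ + 1)) := by
    refine Complex.differentiableOn_tsum_of_summable_norm (Real.summable_pow_div_factorial (‖z‖ + 1)) ?_
      Metric.isOpen_ball ?_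
    · intro i; fun_prop
    · intro i w hw
      have hw : ‖w‖ < ‖z‖ + 1 := by simpa using hw
      have hi : (0:ℝ) ≤ i := by positivity
      have hG : (i.factorial : ℝ) ≤ Real.Gamma (α * i + 2) := by
        calc (i.factorial : ℝ) ≤ ((i+1).factorial : ℝ) := by exact_mod_cast Nat.factorial_le (by omega)
          _ = Real.Gamma ((i + 1 : ℕ) + 1) := (Real.Gamma_nat_eq_factorial _).symm
          _ ≤ _ := by
            apply Real.Gamma_strictMonoOn_Ici.monotoneOn
            · simp; linarith
            · simp; nlinarith
            · push_cast; nlinarith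
      have hp : (0:ℝ) < i.factorial := by positivity
      rw [norm_div, norm_pow, Complex.norm_real, Real.norm_of_nonneg (by linarith)]
      gcongr
  exact this.differentiableAt (Metric.isOpen_ball.mem_nhds (by simp))

theorem ml_term (α : ℝ) (h1 : 1 < α) (k : ℕ) :
    ∫ ξ, mlK ξ * ((α * k + 2) * mlQ α ξ ^ k) = ((Real.Gamma (α * k + 2))⁻¹ : ℝ) := by
  have hk : (0:ℝ) ≤ α * k := by positivity
  have h := ml_invGamma (α * k + 2 + 1) (by linarith)
  rw [Real.Gamma_add_one (by linarith)] at h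
  have : ∀ ξ, mlK ξ * ((α * k + 2) * mlQ α ξ ^ k) =
      (α * k + 2) * (Complex.exp (mlS ξ) * mlS ξ ^ (-((α * k + 2 + 1 : ℝ):ℂ))) := by
    intro ξ
    have e : (-((α * k + 2 + 1 : ℝ):ℂ)) = -((3:ℝ):ℂ) + (-(α:ℂ)) * k := by push_cast; ring
    rw [e, Complex.cpow_add _ _ (mlS_ne ξ), Complex.cpow_mul_nat, mlK, mlQ]
    ring
  simp_rw [this]
  rw [integral_const_mul, h]
  have hne : α * k + 2 ≠ 0 := by linarith
  have hne' : (α * k + 2 : ℂ) ≠ 0 := by exact_mod_cast hne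
  push_cast
  rw [mul_inv, mul_inv_cancel_left₀ hne']

theorem ml_small (α : ℝ) (h1 : 1 < α) (z : ℂ) (hz : ‖z‖ < 1) :
    mlE α z = ∫ ξ, mlH α z ξ := by
  have hq : ∀ ξ, ‖z * mlQ α ξ‖ < 1 := fun ξ => by
    rw [norm_mul]
    have := mlQ_norm_le α ξ (by linarith)
    nlinarith [norm_nonneg z]
  set F : ℕ → ℝ → ℂ := fun k ξ => z ^ k * (mlK ξ * ((α * k + 2) * mlQ α ξ ^ k)) with hF
  have hFn : ∀ k ξ, ‖F k ξ‖ ≤ (α * k + 2) * ‖z‖ ^ k * ‖mlK ξ‖ := by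
    intro k ξ
    have e : ‖(α * k + 2 : ℂ)‖ = α * k + 2 := by
      have : (α * k + 2 : ℂ) = ((α * k + 2 : ℝ) : ℂ) := by push_cast; rfl
      rw [this, Complex.norm_real, Real.norm_of_nonneg (by positivity)]
    simp only [hF, norm_mul, norm_pow, e]
    have := pow_le_one₀ (norm_nonneg _) (mlQ_norm_le α ξ (by linarith)) (n := k)
    have h0 : 0 ≤ (α * k + 2) * ‖z‖ ^ k * ‖mlK ξ‖ := by positivity
    nlinarith
  have hFi : ∀ k, Integrable (F k) := fun k => by
    refine (mlK_int.norm.const_mul ((α * k + 2) * ‖z‖ ^ k)).mono' ?_ (Eventually.of_forall (hFn k))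
    have := mlQ_cont α
    have := mlK_cont
    exact Continuous.aestronglyMeasurable (by fun_prop)
  have hsum : Summable fun k : ℕ => (α * k + 2) * ‖z‖ ^ k := by
    have a := (hasSum_coe_mul_geometric_of_norm_lt_one (r := ‖z‖) (by simpa)).summable.mul_left α
    have b := (summable_geometric_of_lt_one (norm_nonneg z) hz).mul_left 2
    refine (a.add b).congr fun k => by ring
  have hs : Summable fun k => ∫ ξ, ‖F k ξ‖ := by
    refine Summable.of_nonneg_of_le (fun k => integral_nonneg fun _ => norm_nonneg _) (fun k => ?_)
      (hsum.mul_right (∫ ξ, ‖mlK ξ‖))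
    rw [← integral_const_mul]
    exact integral_mono (hFi k).norm (mlK_int.norm.const_mul _) (hFn k)
  have H := hasSum_integral_of_summable_integral_norm hFi hs
  have e1 : ∀ k, ∫ ξ, F k ξ = z ^ k / (Real.Gamma (α * k + 2) : ℂ) := fun k => by
    simp only [hF]
    rw [integral_const_mul, ml_term α h1 k, Complex.ofReal_inv, div_eq_mul_inv]
  have e2 : ∀ ξ, ∑' k, F k ξ = mlH α z ξ := fun ξ => by
    apply HasSum.tsum_eq
    have a := (hasSum_coe_mul_geometric_of_norm_lt_one (hq ξ)).mul_left (α : ℂ)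
    have b := (hasSum_geometric_of_norm_lt_one (hq ξ)).mul_left (2 : ℂ)
    have ab := (a.add b).mul_left (mlK ξ)
    have hne : 1 - z * mlQ α ξ ≠ 0 := by
      intro h
      have := hq ξ
      rw [← sub_eq_zero.1 h] at this
      simp at this
    have g1 : (fun k => F k ξ) = (fun k : ℕ => mlK ξ * (α * (k * (z * mlQ α ξ) ^ k) + 2 * (z * mlQ α ξ) ^ k)) := by
      ext k; simp only [hF, mul_pow]; ring
    have g2 : mlH α z ξ = mlK ξ * (α * (z * mlQ α ξ / (1 - z * mlQ α ξ) ^ 2) + 2 * (1 - z * mlQ α ξ)⁻¹) := by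
      rw [mlH]; congr 1; field_simp; ring
    rw [g1, g2]
    exact ab
  simp_rw [e1, e2] at H
  exact H.tsum_eq

theorem ml_repr (α : ℝ) (h1 : 1 < α) (h2 : α < 2) (x : ℝ) (hx : 0 ≤ x) :
    mlE α (-x) = ∫ ξ, mlH α (-x) ξ := by
  obtain ⟨c, hc, hc1, hlow⟩ := mlQ_lower α h1 h2
  set R : Set ℂ := (fun x : ℝ => (-x : ℂ)) '' Ici 0 with hR
  have hRc : Convex ℝ R := by
    have := (convex_Ici (𝕜 := ℝ) (0:ℝ)).linear_image (-Complex.ofRealCLM.toLinearMap)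
    have e : R = ⇑(-Complex.ofRealCLM.toLinearMap) '' Ici 0 := by
      rw [hR]; rfl
    rw [e]
    exact this
  set U := Metric.thickening (c/2) R with hU
  have hUo : IsOpen U := Metric.isOpen_thickening
  have hRU : R ⊆ U := Metric.self_subset_thickening (by linarith) R
  have hUl : ∀ z ∈ U, ∀ ξ, c / 2 ≤ ‖1 - z * mlQ α ξ‖ := by
    intro z hz ξ
    obtain ⟨_, ⟨y, hy, rfl⟩, hd⟩ := Metric.mem_thickening_iff.1 hz
    rw [dist_eq_norm] at hd
    have a := hlow y hy ξ
    have b : (1 + y * mlQ α ξ) = (1 - z * mlQ α ξ) + (z - (-y)) * mlQ α ξ := by ring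
    rw [b] at a
    have d := norm_add_le (1 - z * mlQ α ξ) ((z - (-y)) * mlQ α ξ)
    rw [norm_mul] at d
    have := mlQ_norm_le α ξ (by linarith)
    nlinarith [norm_nonneg (z - (-y:ℂ))]
  have hmeas : ∀ z ∈ U, AEStronglyMeasurable (mlH α z) volume := by
    intro z hz
    have := mlQ_cont α
    have := mlK_cont
    have h0 : ∀ ξ, 1 - z * mlQ α ξ ≠ 0 := fun ξ => by
      rw [← norm_pos_iff]; linarith [hUl z hz ξ]
    refine Continuous.aestronglyMeasurable ?_
    unfold mlH
    refine mlK_cont.mul ((continuous_const.div (by fun_prop) h0).add (continuous_const.div (by fun_prop) fun ξ => pow_ne_zero 2 (h0 ξ)))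
  have hd : DifferentiableOn ℂ (fun z => ∫ ξ, mlH α z ξ) U := by
    intro z hz
    apply DifferentiableAt.differentiableWithinAt
    have h2a : ‖(2 - α : ℂ)‖ = 2 - α := by
      have : (2 - α : ℂ) = ((2 - α : ℝ) : ℂ) := by push_cast; rfl
      rw [this, Complex.norm_real, Real.norm_of_nonneg (by linarith)]
    have ha : ‖(α : ℂ)‖ = α := by
      rw [Complex.norm_real, Real.norm_of_nonneg (by linarith)]
    refine (hasDerivAt_integral_of_dominated_loc_of_deriv_le (𝕜 := ℂ) (F := mlH α)
      (F' := fun z ξ => mlK ξ * (mlQ α ξ * ((2 - α) / (1 - z * mlQ α ξ) ^ 2 + 2 * α / (1 - z * mlQ α ξ) ^ 3)))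
      (bound := fun ξ => ‖mlK ξ‖ * (1 * ((2 - α) / (c/2)^2 + 2 * α / (c/2)^3)))
      (hUo.mem_nhds hz) ?_ ?_ ?_ ?_ ?_ ?_).2.differentiableAt
    · filter_upwards [hUo.mem_nhds hz] with y hy using hmeas y hy
    · refine (mlK_int.norm.mul_const ((2 - α) / (c/2) + α / (c/2)^2)).mono' (hmeas z hz) ?_
      filter_upwards with ξ
      rw [mlH, norm_mul]
      gcongr
      refine (norm_add_le _ _).trans ?_
      rw [norm_div, norm_div, norm_pow, h2a, ha]
      have := hUl z hz ξ
      have : 0 ≤ 2 - α := by linarith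
      gcongr
    · have := mlQ_cont α
      have := mlK_cont
      have h0 : ∀ ξ, 1 - z * mlQ α ξ ≠ 0 := fun ξ => by
        rw [← norm_pos_iff]; linarith [hUl z hz ξ]
      refine Continuous.aestronglyMeasurable ?_
      refine mlK_cont.mul ((mlQ_cont α).mul ((continuous_const.div (by fun_prop) fun ξ => pow_ne_zero 2 (h0 ξ)).add (continuous_const.div (by fun_prop) fun ξ => pow_ne_zero 3 (h0 ξ))))
    · filter_upwards with ξ y hy
      rw [norm_mul, norm_mul]
      have h3 := hUl y hy ξ
      have h4 : 0 ≤ 2 - α := by linarith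
      have h5 := mlQ_norm_le α ξ (by linarith)
      gcongr
      refine (norm_add_le _ _).trans ?_
      rw [norm_div, norm_div, norm_pow, norm_pow, h2a, norm_mul, ha, Complex.norm_ofNat]
      gcongr
    · exact mlK_int.norm.mul_const _
    · filter_upwards with ξ y hy
      have h0 : 1 - y * mlQ α ξ ≠ 0 := by
        rw [← norm_pos_iff]; linarith [hUl y hy ξ]
      have hD : HasDerivAt (fun y => 1 - y * mlQ α ξ) (-mlQ α ξ) y := by
        simpa using ((hasDerivAt_id y).mul_const (mlQ α ξ)).const_sub 1
      unfold mlH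
      refine HasDerivAt.const_mul _ ?_
      refine (((hasDerivAt_const y (2 - α : ℂ)).fun_div hD h0).fun_add ((hasDerivAt_const y (α : ℂ)).fun_div (hD.fun_pow 2) (pow_ne_zero 2 h0))).congr_deriv ?_
      field_simp
      push_cast
      ring
  have h0U : (0:ℂ) ∈ U := hRU ⟨0, by simp, by simp⟩
  refine ((mlE_diff α h1).differentiableOn.analyticOnNhd hUo).eqOn_of_preconnected_of_eventuallyEq
    (hd.analyticOnNhd hUo) (hRc.thickening _).isPreconnected h0U ?_ (hRU ⟨x, hx, rfl⟩)
  filter_upwards [Metric.ball_mem_nhds (0:ℂ) one_pos] with z hz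
  exact ml_small α h1 z (by simpa using hz)

theorem ml_lim (α : ℝ) (h1 : 1 < α) (h2 : α < 2) :
    Tendsto (fun x : ℝ => (x : ℂ) * mlE α (-x)) atTop (𝓝 (((Real.Gamma (2 - α))⁻¹ : ℝ) : ℂ)) := by
  obtain ⟨c, hc, hc1, hlow⟩ := mlQ_lower α h1 h2
  have h2a : ‖(2 - α : ℂ)‖ = 2 - α := by
    have : (2 - α : ℂ) = ((2 - α : ℝ) : ℂ) := by push_cast; rfl
    rw [this, Complex.norm_real, Real.norm_of_nonneg (by linarith)]
  have ha : ‖(α : ℂ)‖ = α := by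
    rw [Complex.norm_real, Real.norm_of_nonneg (by linarith)]
  have hD0 : ∀ x : ℝ, 0 ≤ x → ∀ ξ, 1 + x * mlQ α ξ ≠ 0 := fun x hx ξ => by
    rw [← norm_pos_iff]; linarith [hlow x hx ξ]
  set G : ℝ → ℝ → ℂ := fun x ξ => mlK ξ * (mlQ α ξ)⁻¹ *
    ((1 - (1 + x * mlQ α ξ)⁻¹) * ((2 - α) + α * (1 + x * mlQ α ξ)⁻¹)) with hG
  have hGH : ∀ x : ℝ, 0 ≤ x → ∀ ξ, (x:ℂ) * mlH α (-x) ξ = G x ξ := by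
    intro x hx ξ
    have := hD0 x hx ξ
    have := mlQ_ne α ξ
    simp only [hG, mlH, neg_mul, sub_neg_eq_add]
    field_simp
    ring
  have hKQ : ∀ ξ, mlK ξ * (mlQ α ξ)⁻¹ = Complex.exp (mlS ξ) * mlS ξ ^ (-((3 - α : ℝ) : ℂ)) := by
    intro ξ
    have e : (-((3 - α : ℝ):ℂ)) = -((3:ℝ):ℂ) + α := by push_cast; ring
    rw [e, Complex.cpow_add _ _ (mlS_ne ξ), mlK, mlQ, Complex.cpow_neg _ (α:ℂ), inv_inv, mul_assoc]
  have hlimval : ∫ ξ, mlK ξ * (mlQ α ξ)⁻¹ * ((1 - 0) * ((2 - α) + α * 0)) = (((Real.Gamma (2 - α))⁻¹ : ℝ) : ℂ) := by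
    rw [integral_mul_const]
    simp_rw [hKQ]
    rw [ml_invGamma _ (by linarith)]
    have : Real.Gamma (3 - α) = (2 - α) * Real.Gamma (2 - α) := by
      rw [← Real.Gamma_add_one (by linarith)]; congr 1; ring
    rw [this]
    have hne : (2 - α : ℂ) ≠ 0 := by
      rw [← norm_pos_iff, h2a]; linarith
    push_cast
    rw [mul_inv]
    field_simp
    ring
  rw [← hlimval]
  have hev : (fun x : ℝ => ∫ ξ, G x ξ) =ᶠ[atTop] (fun x : ℝ => (x : ℂ) * mlE α (-x)) := by
    filter_upwards [eventually_ge_atTop 0] with x hx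
    rw [ml_repr α h1 h2 x hx, ← integral_const_mul]
    simp_rw [hGH x hx]
  refine Tendsto.congr' hev ?_
  refine tendsto_integral_filter_of_dominated_convergence
    (fun ξ => (Real.exp 1 * ‖mlS ξ‖ ^ (-(3 - α))) * ((1 + c⁻¹) * ((2 - α) + α * c⁻¹))) ?_ ?_ ?_ ?_
  · filter_upwards [eventually_ge_atTop 0] with x hx
    refine Continuous.aestronglyMeasurable ?_
    have hq := mlQ_cont α
    have hi : Continuous fun ξ => (1 + x * mlQ α ξ)⁻¹ := Continuous.inv₀ (by fun_prop) (hD0 x hx)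
    exact (mlK_cont.mul (hq.inv₀ (mlQ_ne α))).mul ((continuous_const.sub hi).mul (continuous_const.add (continuous_const.mul hi)))
  · filter_upwards [eventually_ge_atTop 0] with x hx
    filter_upwards with ξ
    have hi : ‖(1 + x * mlQ α ξ)⁻¹‖ ≤ c⁻¹ := by
      rw [norm_inv]; exact inv_anti₀ hc (hlow x hx ξ)
    have hk : ‖mlK ξ * (mlQ α ξ)⁻¹‖ = Real.exp 1 * ‖mlS ξ‖ ^ (-(3 - α)) := by
      rw [hKQ, norm_mul, Complex.norm_exp, mlS_re, ← Complex.ofReal_neg, Complex.norm_cpow_real]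
    simp only [hG]
    rw [norm_mul, hk, norm_mul]
    have e1 : ‖1 - (1 + x * mlQ α ξ)⁻¹‖ ≤ 1 + c⁻¹ := by
      refine (norm_sub_le _ _).trans ?_
      rw [norm_one]; gcongr
    have e2 : ‖(2 - α : ℂ) + α * (1 + x * mlQ α ξ)⁻¹‖ ≤ (2 - α) + α * c⁻¹ := by
      refine (norm_add_le _ _).trans ?_
      rw [norm_mul, h2a, ha]; gcongr
    gcongr
  · exact ((mlS_int (3 - α) (by linarith)).const_mul _).mul_const _
  · filter_upwards with ξ
    have ht : Tendsto (fun x : ℝ => (1 + x * mlQ α ξ)⁻¹) atTop (𝓝 0) := by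
      apply Filter.tendsto_inv₀_cobounded.comp
      rw [← tendsto_norm_atTop_iff_cobounded]
      have hq : 0 < ‖mlQ α ξ‖ := norm_pos_iff.2 (mlQ_ne α ξ)
      have : Tendsto (fun x : ℝ => x * ‖mlQ α ξ‖ - 1) atTop atTop :=
        tendsto_atTop_add_const_right _ _ (tendsto_id.atTop_mul_const hq)
      refine tendsto_atTop_mono' _ ?_ this
      filter_upwards [eventually_ge_atTop 0] with x hx
      have := norm_sub_le (1 + x * mlQ α ξ) 1
      rw [add_sub_cancel_left, norm_mul, Complex.norm_real, Real.norm_of_nonneg hx, norm_one] at this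
      linarith
    exact ((tendsto_const_nhds.sub ht).mul (tendsto_const_nhds.add (tendsto_const_nhds.mul ht))).const_mul _

theorem ml_real (α x : ℝ) : mlE α (-x) = (mittagLeffler α 2 (-x) : ℝ) := by
  rw [mlE, mittagLeffler, Complex.ofReal_tsum]
  congr 1 with k
  push_cast
  rfl

theorem ml_lim_real (α : ℝ) (h1 : 1 < α) (h2 : α < 2) :
    Tendsto (fun x : ℝ => x * mittagLeffler α 2 (-x)) atTop (𝓝 (Real.Gamma (2 - α))⁻¹) := by
  have h := (Complex.continuous_re.tendsto _).comp (ml_lim α h1 h2)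
  rw [Complex.ofReal_re] at h
  refine h.congr fun x => ?_
  simp only [Function.comp]
  rw [ml_real, ← Complex.ofReal_mul, Complex.ofReal_re]

/-- for `4/3 < α < 2`, `T > 0` and a nondecreasing sequence `λ_n > 0`
tending to `∞` with `E_{α,2}(−λ_n T^α) ≠ 0` for all `n`, there is `C_T > 0` with
`C_T⁻¹/(1 + λ_n T^α) ≤ |E_{α,2}(−λ_n T^α)| ≤ C_T/(1 + λ_n T^α)` for every `n`. -/
theorem mittagLeffler_two_sided_bound_seq (α T : ℝ) (hα1 : 4 / 3 < α) (hα2 : α < 2)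
    (hT : 0 < T) (lam : ℕ → ℝ) (hmono : Monotone lam) (hpos : ∀ n, 0 < lam n)
    (htend : Filter.Tendsto lam Filter.atTop Filter.atTop)
    (hne : ∀ n, mittagLeffler α 2 (-(lam n * T ^ α)) ≠ 0) :
    ∃ C : ℝ, 0 < C ∧ ∀ n : ℕ,
      C⁻¹ / (1 + lam n * T ^ α) ≤ |mittagLeffler α 2 (-(lam n * T ^ α))| ∧
      |mittagLeffler α 2 (-(lam n * T ^ α))| ≤ C / (1 + lam n * T ^ α) := by
  have hTα : 0 < T ^ α := Real.rpow_pos_of_pos hT α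
  set x : ℕ → ℝ := fun n => lam n * T ^ α with hx
  have hx0 : ∀ n, 0 < x n := fun n => mul_pos (hpos n) hTα
  have hxt : Tendsto x atTop atTop := htend.atTop_mul_const hTα
  set L := (Real.Gamma (2 - α))⁻¹ with hL
  have hL0 : 0 < L := inv_pos.2 (Real.Gamma_pos_of_pos (by linarith))
  have hlim := (ml_lim_real α (by linarith) hα2).comp hxt
  have hinv : Tendsto (fun n => (x n)⁻¹ + 1) atTop (𝓝 (0 + 1)) :=
    (tendsto_inv_atTop_zero.comp hxt).add_const 1
  have hb : Tendsto (fun n => (1 + x n) * |mittagLeffler α 2 (-(x n))|) atTop (𝓝 L) := by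
    have := (hinv.mul hlim).abs
    rw [zero_add, one_mul, abs_of_pos hL0] at this
    refine this.congr fun n => ?_
    have h := hx0 n
    simp only [Function.comp]
    rw [← mul_assoc, abs_mul]
    congr 1
    rw [add_mul, inv_mul_cancel₀ h.ne', one_mul, abs_of_pos (by linarith)]
  have hb' := hb.inv₀ hL0.ne'
  obtain ⟨A, hA⟩ := hb.bddAbove_range
  obtain ⟨B, hB⟩ := hb'.bddAbove_range
  have hC : 0 < max 1 (max A B) := lt_of_lt_of_le one_pos (le_max_left _ _)
  refine ⟨max 1 (max A B), hC, fun n => ?_⟩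
  have h1 : 0 < 1 + x n := by linarith [hx0 n]
  have ha : 0 < (1 + x n) * |mittagLeffler α 2 (-(x n))| := mul_pos h1 (abs_pos.2 (hne n))
  have hAn := hA (mem_range_self n)
  have hBn := hB (mem_range_self n)
  constructor
  · rw [div_le_iff₀ h1, mul_comm |_|]
    rw [inv_le_comm₀ hC ha]
    exact hBn.trans ((le_max_right _ _).trans (le_max_right _ _))
  · rw [le_div_iff₀ h1, mul_comm |_|]
    exact hAn.trans ((le_max_left _ _).trans (le_max_right _ _))
end

section
/- Let 1 < α ≤ 4/3 and γ ∈ ℝ. Then there exists a constant C > 0 depending only on α such that the following holds: for every T > 0, every nondecreasing sequence λ : ℕ → ℝ of positive numbers with λ_0 T^α ≥ 1, and every sequence a : ℕ → ℝ, if b_n := T · E_{α,2}(−λ_n T^α) · a_n and the series ∑_{n} λ_n^{2−2γ} b_n² converges, then the series ∑_{n} λ_n^{−2γ} a_n² converges and ∑_{n} λ_n^{−2γ} a_n² ≤ C · T^{2(α−1)} · ∑_{n} λ_n^{2−2γ} b_n². -/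
open Real Set Filter Topology MeasureTheory

theorem osc_aux (a y : ℝ) (hy : 0 ≤ y) (hy' : y ≤ π) :
    Real.cos y - a * Real.sin y ≤ Real.exp (-(a * y)) := by
  have hanti : AntitoneOn (fun y => Real.exp (a*y) * (Real.cos y - a * Real.sin y)) (Icc 0 π) := by
    have hd : ∀ x, HasDerivAt (fun y => Real.exp (a*y) * (Real.cos y - a * Real.sin y))
      (-(1+a^2) * Real.exp (a*x) * Real.sin x) x := by
      intro x
      have h1 : HasDerivAt (fun y => Real.exp (a*y)) (Real.exp (a*x) * (a * 1)) x :=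
        ((hasDerivAt_id x).const_mul a).exp
      have h2 := (Real.hasDerivAt_cos x).sub ((Real.hasDerivAt_sin x).const_mul a)
      refine (h1.mul h2).congr_deriv ?_
      simp only [Pi.sub_apply]
      ring
    apply antitoneOn_of_deriv_nonpos (convex_Icc 0 π)
    · exact fun x _ => (hd x).continuousAt.continuousWithinAt
    · exact fun x _ => (hd x).differentiableAt.differentiableWithinAt
    · intro x hx
      rw [interior_Icc] at hx
      rw [(hd x).deriv]
      have := Real.sin_nonneg_of_nonneg_of_le_pi hx.1.le hx.2.le
      have h3 : 0 ≤ (1+a^2) * Real.exp (a*x) * Real.sin x := by positivity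
      linarith
  have := hanti ⟨le_rfl, pi_pos.le⟩ ⟨hy, hy'⟩ hy
  simp at this
  rw [Real.exp_neg, ← one_div, le_div_iff₀ (Real.exp_pos _)]
  linarith

theorem osc_bound (α t : ℝ) (hα1 : 1 < α) (hα2 : α ≤ 4/3) (ht : 1 ≤ t) :
    -(Real.exp (t * cos (π/α)) * cos (t * sin (π/α) - π/α)) ≤
     Real.exp (-(1/100)) * (Real.exp (-((1-α/2)/(-cos (π/α)) * t)) * (-cos (π/α))) := by
  obtain ⟨φ, hφ⟩ : ∃ φ, φ = π - π/α := ⟨_, rfl⟩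
  have hθ : π/α = π - φ := by rw [hφ]; ring
  have hα0 : 0 < α := by linarith
  have hπ := pi_pos
  have hφα : α * φ = π * (α - 1) := by rw [hφ]; field_simp
  have hφ0 : 0 < φ := by
    have : 0 < α * φ := by rw [hφα]; apply mul_pos hπ; linarith
    exact pos_of_mul_pos_right this hα0.le
  have hφ4 : φ ≤ π/4 := by
    have : π * (3/4) ≤ π/α := by
      rw [le_div_iff₀ hα0]; nlinarith
    linarith
  rw [hθ, cos_pi_sub, sin_pi_sub]
  have e1 : cos (t * sin φ - (π - φ)) = - cos (t * sin φ + φ) := by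
    rw [← cos_sub_pi]; ring_nf
  rw [e1]
  simp only [mul_neg, neg_neg]
  have hs0 : 0 < sin φ := sin_pos_of_pos_of_lt_pi hφ0 (by linarith)
  have hsφ : sin φ ≤ φ := sin_le hφ0.le
  have hcos : √2/2 ≤ cos φ := by
    rw [← cos_pi_div_four]; exact cos_le_cos_of_nonneg_of_le_pi hφ0.le (by linarith) hφ4
  have hq2 : (1.414:ℝ) ≤ √2 := by apply Real.le_sqrt_of_sq_le; norm_num
  have hq2' : √2^2 = 2 := Real.sq_sqrt (by norm_num)
  have hc0 : 0 < cos φ := by linarith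
  have hc1 : cos φ ≤ 1 := cos_le_one φ
  have hsc := sin_sq_add_cos_sq φ
  have hs2 : sin φ^2 ≤ 1/2 := by nlinarith
  set c := cos φ with hc
  set s := sin φ with hs
  by_cases hcase : t * s ≤ π
  · have h1 : cos (t*s+φ) = c * (cos (t*s) - (s/c) * sin (t*s)) := by
      rw [cos_add]; field_simp; ring
    have h2 := osc_aux (s/c) (t*s) (by positivity) hcase
    rw [h1]
    calc rexp (-(t * c)) * (c * (cos (t * s) - s / c * sin (t * s)))
        = rexp (-(t * c)) * (c * (cos (t * s) - s / c * sin (t * s))) := by ring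
      _ ≤ rexp (-(t * c)) * (c * rexp (-(s/c*(t*s)))) := by gcongr
      _ = (rexp (-(t * c)) * rexp (-(s/c*(t*s)))) * c := by ring
      _ = rexp (-(t/c)) * c := by
          rw [← Real.exp_add]; congr 2; field_simp; linear_combination -hsc
      _ ≤ (rexp (-(1/100)) * rexp (-((1-α/2)/c*t))) * c := by
          rw [← Real.exp_add]; gcongr
          have : t/c - (1-α/2)/c*t = t * (α/2) / c := by ring
          have : 1/2 ≤ t * (α/2) / c := by
            rw [le_div_iff₀ hc0]; nlinarith
          linarith
      _ = _ := by ring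
  · push Not at hcase
    have hlog : rexp (-(49/100)) ≤ c := by
      have : c⁻¹ ≤ rexp (49/100) := by
        have := Real.add_one_le_exp (49/100:ℝ)
        refine le_trans ?_ this
        rw [inv_le_comm₀ hc0 (by norm_num)]
        norm_num; linarith
      rw [inv_le_comm₀ hc0 (by positivity), ← Real.exp_neg] at this
      exact this
    have ht' : π ≤ t * φ := by nlinarith
    have hk : 1/2 ≤ t * (α/2 - s^2) := by
      have : φ/(2*π) ≤ α/2 - s^2 := by
        rw [div_le_iff₀ (by positivity)]
        nlinarith
      calc (1/2:ℝ) = π/(2*π) := by field_simp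
        _ ≤ t * φ/(2*π) := by gcongr
        _ = t * (φ/(2*π)) := by ring
        _ ≤ _ := by gcongr
    calc rexp (-(t * c)) * cos (t * s + φ) ≤ rexp (-(t * c)) * 1 := by
          gcongr; exact cos_le_one _
      _ ≤ rexp (-(1/100)) * rexp (-((1-α/2)/c*t)) * rexp (-(49/100)) := by
          rw [mul_one, ← Real.exp_add, ← Real.exp_add]
          gcongr
          have : t * c - (1-α/2)/c*t = t * (α/2 - s^2)/c := by
            field_simp; linear_combination 2*hsc
          have : 1/2 ≤ t * (α/2 - s^2)/c := by
            rw [le_div_iff₀ hc0]; nlinarith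
          linarith
      _ ≤ rexp (-(1/100)) * rexp (-((1-α/2)/c*t)) * c := by gcongr
      _ = _ := by ring

noncomputable def kden (α u : ℝ) : ℝ :=
  1 + 2 * Real.exp (-(α*u)) * cos (π*α) + Real.exp (-(α*u))^2

noncomputable def kk (α u : ℝ) : ℝ :=
  (-sin (π*α)/π) * Real.exp (-((1+α)*u)) / kden α u

theorem sin_neg_aux (α : ℝ) (hα1 : 1 < α) (hα2 : α ≤ 4/3) : sin (π*α) < 0 := by
  have h : sin (π*α) = - sin (π*(α-1)) := by
    rw [show π*α = π*(α-1) + π by ring, sin_add_pi]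
  rw [h]
  have := sin_pos_of_pos_of_lt_pi (x := π*(α-1)) (mul_pos pi_pos (by linarith))
    (by nlinarith [pi_pos])
  linarith

theorem kden_ge1 (α u : ℝ) : sin (π*α)^2 ≤ kden α u := by
  unfold kden; nlinarith [sq_nonneg (Real.exp (-(α*u)) + cos (π*α)), sin_sq_add_cos_sq (π*α)]

theorem kden_ge2 (α u : ℝ) : Real.exp (-(α*u))^2 * sin (π*α)^2 ≤ kden α u := by
  unfold kden
  have := sin_sq_add_cos_sq (π*α)
  have h2 : sin (π*α)^2 = 1 - cos (π*α)^2 := by linarith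
  rw [h2]
  nlinarith [sq_nonneg (1 + Real.exp (-(α*u)) * cos (π*α))]

theorem kden_pos (α u : ℝ) (hα1 : 1 < α) (hα2 : α ≤ 4/3) : 0 < kden α u :=
  lt_of_lt_of_le (sq_pos_of_neg (sin_neg_aux α hα1 hα2)) (kden_ge1 α u)

theorem kk_nonneg (α u : ℝ) (hα1 : 1 < α) (hα2 : α ≤ 4/3) : 0 ≤ kk α u := by
  have := kden_pos α u hα1 hα2
  have := sin_neg_aux α hα1 hα2
  have h : 0 ≤ -sin (π*α)/π := div_nonneg (by linarith) pi_pos.le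
  unfold kk; positivity

theorem kk_cont (α : ℝ) (hα1 : 1 < α) (hα2 : α ≤ 4/3) : Continuous (kk α) := by
  unfold kk
  refine Continuous.div ?_ ?_ (fun u => (kden_pos α u hα1 hα2).ne')
  · fun_prop
  · unfold kden; fun_prop

theorem kk_le (α u : ℝ) (hα1 : 1 < α) (hα2 : α ≤ 4/3) :
    kk α u ≤ (-1/(π * sin (π*α))) * Real.exp (-((α-1)*|u|)) ∧
    Real.exp u * kk α u ≤ (-1/(π * sin (π*α))) * Real.exp (-((α-1)*|u|)) := by
  have hs := sin_neg_aux α hα1 hα2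
  have hs2 : 0 < sin (π*α)^2 := sq_pos_of_neg hs
  have hd := kden_pos α u hα1 hα2
  have hC : 0 ≤ -sin (π*α)/π := div_nonneg (by linarith) pi_pos.le
  have hCe : -1/(π * sin (π*α)) = (-sin (π*α)/π) / sin (π*α)^2 := by
    have := hs.ne; have := pi_ne_zero; field_simp
  have key : ∀ b, 0 ≤ b → b ≤ 1 → Real.exp (b*u) * kk α u ≤ (-1/(π * sin (π*α))) * Real.exp (-((α-1)*|u|)) := by
    intro b hb0 hb1
    have e : Real.exp (b*u) * kk α u = (-sin (π*α)/π) * (Real.exp ((b-(1+α))*u) / kden α u) := by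
      unfold kk
      rw [show (b-(1+α))*u = b*u + -((1+α)*u) by ring, Real.exp_add]; ring
    rw [e, hCe, div_mul_eq_mul_div (-sin (π*α)/π) (sin (π*α)^2), mul_div_assoc (-sin (π*α)/π)]
    apply mul_le_mul_of_nonneg_left _ hC
    rcases le_total 0 u with hu | hu
    · rw [abs_of_nonneg hu]
      apply div_le_div₀ (by positivity) _ hs2 (kden_ge1 α u)
      apply Real.exp_le_exp.2; nlinarith
    · rw [abs_of_nonpos hu]
      calc Real.exp ((b-(1+α))*u) / kden α u ≤ Real.exp ((b-(1+α))*u) / (Real.exp (-(α*u))^2 * sin (π*α)^2) := by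
            apply div_le_div_of_nonneg_left (by positivity) (by positivity) (kden_ge2 α u)
        _ = Real.exp ((b-(1-α))*u) / sin (π*α)^2 := by
            rw [← div_div]; congr 1
            rw [div_eq_iff (by positivity), ← Real.exp_nat_mul, ← Real.exp_add]
            congr 1; push_cast; ring
        _ ≤ _ := by
            gcongr
            nlinarith
  constructor
  · simpa using key 0 le_rfl zero_le_one
  · simpa using key 1 zero_le_one le_rfl

theorem integrable_exp_abs (c : ℝ) (hc : 0 < c) : Integrable (fun u : ℝ => Real.exp (-(c*|u|))) := by
  rw [← integrableOn_univ, ← Iic_union_Ioi (a := (0:ℝ))]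
  apply IntegrableOn.union
  · refine (integrableOn_exp_mul_Iic hc 0).congr_fun (fun u hu => ?_) measurableSet_Iic
    simp only [abs_of_nonpos (mem_Iic.1 hu)]; congr 1; ring
  · refine (integrableOn_exp_mul_Ioi (neg_lt_zero.2 hc) 0).congr_fun (fun u hu => ?_) measurableSet_Ioi
    simp only [abs_of_pos (mem_Ioi.1 hu)]; congr 1; ring

theorem kk_int (α : ℝ) (hα1 : 1 < α) (hα2 : α ≤ 4/3) : Integrable (kk α) := by
  refine ((integrable_exp_abs (α-1) (by linarith)).const_mul (-1/(π * sin (π*α)))).mono'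
    (kk_cont α hα1 hα2).aestronglyMeasurable (ae_of_all _ fun u => ?_)
  rw [Real.norm_of_nonneg (kk_nonneg α u hα1 hα2)]
  exact (kk_le α u hα1 hα2).1

theorem kk_int' (α : ℝ) (hα1 : 1 < α) (hα2 : α ≤ 4/3) : Integrable (fun u => Real.exp u * kk α u) := by
  refine ((integrable_exp_abs (α-1) (by linarith)).const_mul (-1/(π * sin (π*α)))).mono'
    (Real.continuous_exp.mul (kk_cont α hα1 hα2)).aestronglyMeasurable (ae_of_all _ fun u => ?_)
  rw [Real.norm_of_nonneg (mul_nonneg (Real.exp_nonneg _) (kk_nonneg α u hα1 hα2))]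
  exact (kk_le α u hα1 hα2).2

theorem kk_int_t (α t : ℝ) (hα1 : 1 < α) (hα2 : α ≤ 4/3) (ht : 0 ≤ t) :
    Integrable (fun u => Real.exp (-(t * Real.exp u)) * kk α u) := by
  have hk := kk_cont α hα1 hα2
  refine (kk_int α hα1 hα2).mono' (by fun_prop) (ae_of_all _ fun u => ?_)
  have := kk_nonneg α u hα1 hα2
  rw [Real.norm_of_nonneg (by positivity)]
  have : Real.exp (-(t * Real.exp u)) ≤ 1 := by
    rw [Real.exp_le_one_iff]; have : 0 ≤ t * Real.exp u := by positivity
    linarith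
  nlinarith

noncomputable def gg (α t : ℝ) : ℝ := ∫ u, Real.exp (-(t * Real.exp u)) * kk α u

noncomputable def osc (α t : ℝ) : ℝ :=
  2/α * (Real.exp (t * cos (π/α)) * cos (t * sin (π/α) - π/α))


/-- the circle integral in logarithmic coordinates -/
noncomputable def DD (G : ℂ → ℂ) (l : ℝ) : ℂ := ∫ θ in (-π)..π, G (l + θ * Complex.I)

theorem shift_limit (G : ℂ → ℂ) (h : ℝ → ℂ) (l : ℝ) (v c : ℂ)
    (hrect : ∀ᶠ L : ℝ in atBot, (∫ u in L..l, h u) + Complex.I * DD G l - Complex.I * DD G L = v)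
    (hD : Tendsto (DD G) atBot (𝓝 c)) (hint : IntegrableOn h (Iic l)) :
    (∫ u in Iic l, h u) + Complex.I * DD G l - Complex.I * c = v := by
  have h1 := intervalIntegral_tendsto_integral_Iic l hint tendsto_id
  have h2 := (h1.add_const (Complex.I * DD G l)).sub (hD.const_mul Complex.I)
  refine tendsto_nhds_unique h2 (Tendsto.congr' ?_ tendsto_const_nhds)
  filter_upwards [hrect] with L hL
  exact hL.symm

theorem rect_cont (G : ℂ → ℂ) (L l : ℝ) (hL : L ≤ l)
    (hG : ContinuousOn G (uIcc L l ×ℂ uIcc (-π) π))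
    (hd : DifferentiableOn ℂ G (Ioo L l ×ℂ Ioo (-π) π)) :
    (∫ u in L..l, (G (u - π * Complex.I) - G (u + π * Complex.I)))
      + Complex.I * DD G l - Complex.I * DD G L = 0 := by
  have hπ := pi_pos
  have := Complex.integral_boundary_rect_eq_zero_of_continuousOn_of_differentiableOn G
    (⟨L, -π⟩ : ℂ) (⟨l, π⟩ : ℂ) hG (by simpa [min_eq_left hL, max_eq_right hL, hπ.le, (neg_le_self hπ.le)] using hd)
  simp only [smul_eq_mul] at this
  rw [intervalIntegral.integral_sub]
  · unfold DD
    rw [← this]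
    push_cast
    simp only [neg_mul, ← sub_eq_add_neg]
  · apply ContinuousOn.intervalIntegrable
    refine hG.comp (by fun_prop) ?_
    intro u hu
    simp [Complex.mem_reProdIm, hu]
  · apply ContinuousOn.intervalIntegrable
    refine hG.comp (by fun_prop) ?_
    intro u hu
    simp [Complex.mem_reProdIm, hu]

noncomputable def Phi (t b : ℝ) (w : ℂ) : ℂ := Complex.exp (t * Complex.exp w) * Complex.exp (-(b * w))

theorem Phi_diff (t b : ℝ) : Differentiable ℂ (Phi t b) := by
  unfold Phi; fun_prop

theorem exp_up (u : ℝ) : Complex.exp (u + π * Complex.I) = -(Real.exp u : ℂ) := by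
  rw [Complex.exp_add, Complex.exp_pi_mul_I, Complex.ofReal_exp]; ring

theorem exp_dn (u : ℝ) : Complex.exp (u - π * Complex.I) = -(Real.exp u : ℂ) := by
  rw [Complex.exp_sub, Complex.exp_pi_mul_I, Complex.ofReal_exp]; ring

theorem Phi_jump (t b u : ℝ) : Phi t b (u - π * Complex.I) - Phi t b (u + π * Complex.I) =
    2 * Complex.I * (sin (π*b) * Real.exp (-(t * Real.exp u) - b*u) : ℝ) := by
  unfold Phi
  rw [exp_up, exp_dn, ← mul_sub]
  have h1 : Complex.exp (-(b * (u - π * Complex.I))) = Complex.exp (-(b*u)) * Complex.exp ((π*b:ℝ) * Complex.I) := by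
    rw [← Complex.exp_add]; congr 1; push_cast; ring
  have h2 : Complex.exp (-(b * (u + π * Complex.I))) = Complex.exp (-(b*u)) * Complex.exp (-((π*b:ℝ) * Complex.I)) := by
    rw [← Complex.exp_add]; congr 1; push_cast; ring
  rw [h1, h2, ← mul_sub]
  have h3 : Complex.exp ((π*b:ℝ) * Complex.I) - Complex.exp (-((π*b:ℝ) * Complex.I)) = 2 * Complex.I * (sin (π*b) : ℝ) := by
    rw [← neg_mul, Complex.exp_mul_I, Complex.exp_mul_I, Complex.cos_neg, Complex.sin_neg, Complex.ofReal_sin]; ring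
  rw [h3, Complex.ofReal_mul, Complex.ofReal_exp]
  push_cast
  rw [sub_eq_add_neg, Complex.exp_add]
  ring_nf

theorem Phi_jump_int (t b l : ℝ) (ht : 0 < t) (hb : b < 0) :
    IntegrableOn (fun u : ℝ => Real.exp (-(t * Real.exp u) - b*u)) (Iic l) := by
  refine (integrableOn_exp_mul_Iic (a := -b) (by linarith) l).mono' (by fun_prop) (ae_of_all _ fun u => ?_)
  rw [Real.norm_of_nonneg (Real.exp_nonneg _)]
  apply Real.exp_le_exp.2
  have : 0 ≤ t * Real.exp u := by positivity
  linarith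

theorem tail_int (t b l : ℝ) (ht : 0 < t) :
    IntegrableOn (fun u : ℝ => Real.exp (-(t * Real.exp u) - b*u)) (Ioi l) := by
  refine integrable_of_isBigO_exp_neg (b := 1) one_pos (by fun_prop) ?_
  apply Asymptotics.IsBigO.of_bound 1
  -- exp growth
  have h1 : Tendsto (fun u : ℝ => Real.exp u / u^1) atTop atTop := Real.tendsto_exp_div_pow_atTop 1
  filter_upwards [h1.eventually_ge_atTop ((1-b)/t), eventually_gt_atTop 0] with u hu hu0
  rw [one_mul, Real.norm_of_nonneg (Real.exp_nonneg _), Real.norm_of_nonneg (Real.exp_nonneg _)]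
  apply Real.exp_le_exp.2
  rw [pow_one, div_le_div_iff₀ ht hu0] at hu
  linarith

theorem gamma_log (t b : ℝ) (ht : 0 < t) (hb : b < 0) :
    ∫ u, Real.exp (-(t * Real.exp u) - b*u) = t^b * Real.Gamma (-b) := by
  have h := Real.integral_rpow_mul_exp_neg_mul_Ioi (a := -b) (r := t) (by linarith) ht
  have h2 := integral_image_eq_integral_abs_deriv_smul (s := univ) (f := Real.exp) (f' := Real.exp) MeasurableSet.univ
    (fun x _ => (Real.hasDerivAt_exp x).hasDerivWithinAt) Real.exp_injective.injOn
    (fun r => r^(-b-1) * Real.exp (-(t*r)))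
  rw [image_univ, Real.range_exp, h] at h2
  rw [setIntegral_univ] at h2
  rw [one_div, Real.inv_rpow ht.le, Real.rpow_neg ht.le, inv_inv] at h2
  rw [h2]
  congr 1; ext u
  rw [abs_of_pos (Real.exp_pos u), smul_eq_mul, ← Real.exp_mul, ← Real.exp_add, ← Real.exp_add]
  congr 1; ring

theorem Phi_DD_bound (t b l : ℝ) (ht : 0 < t) :
    ∀ θ : ℝ, ‖Phi t b (l + θ * Complex.I)‖ ≤ Real.exp (t * Real.exp l - b * l) := by
  intro θ
  unfold Phi
  rw [norm_mul, Complex.norm_exp, Complex.norm_exp, ← Real.exp_add]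
  apply Real.exp_le_exp.2
  have h1 : (-(b * (l + θ * Complex.I)) : ℂ).re = -(b*l) := by simp
  have h2 : (t * Complex.exp (l + θ * Complex.I)).re ≤ t * Real.exp l := by
    rw [Complex.re_ofReal_mul]
    gcongr
    refine (Complex.re_le_norm _).trans ?_
    rw [Complex.norm_exp]; simp
  rw [h1]; linarith

theorem Phi_rect (t b L l : ℝ) (hL : L ≤ l) :
  (∫ u in L..l, (2 * Complex.I * (sin (π*b) * Real.exp (-(t * Real.exp u) - b*u) : ℝ) : ℂ))
      + Complex.I * DD (Phi t b) l - Complex.I * DD (Phi t b) L = 0 := by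
  have := rect_cont (Phi t b) L l hL (Phi_diff t b).continuous.continuousOn (Phi_diff t b).differentiableOn
  simpa only [Phi_jump] using this

/-- Hankel's formula -/
def Hank (t b l : ℝ) : Prop :=
  DD (Phi t b) l = ((2 * π * (t^b / Real.Gamma (b+1)) +
    2 * sin (π*b) * ∫ u in Ioi l, Real.exp (-(t * Real.exp u) - b*u) : ℝ) : ℂ)

theorem hank_neg (t b l : ℝ) (ht : 0 < t) (hb : b < 0) (hb1 : -1 < b) : Hank t b l := by
  have hint := Phi_jump_int t b l ht hb
  have hD : Tendsto (DD (Phi t b)) atBot (𝓝 0) := by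
    have hb' : ∀ l', ‖DD (Phi t b) l'‖ ≤ Real.exp (t * Real.exp l' - b * l') * |π - (-π)| := fun l' =>
      intervalIntegral.norm_integral_le_of_norm_le_const (fun θ _ => Phi_DD_bound t b l' ht θ)
    refine squeeze_zero_norm hb' ?_
    rw [show (0:ℝ) = 0 * |π - (-π)| by simp]
    apply Tendsto.mul_const
    apply Real.tendsto_exp_atBot.comp
    have h1 : Tendsto (fun l' : ℝ => t * Real.exp l') atBot (𝓝 (t*0)) := Real.tendsto_exp_atBot.const_mul t
    have h2 : Tendsto (fun l' : ℝ => -b * l') atBot atBot := tendsto_id.const_mul_atBot (by linarith)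
    have := h1.add_atBot h2
    refine this.congr fun x => by ring
  have := shift_limit (Phi t b)
    (fun u => (2 * Complex.I * (sin (π*b) * Real.exp (-(t * Real.exp u) - b*u) : ℝ) : ℂ)) l 0 0
    (by filter_upwards [eventually_le_atBot l] with L hL; exact Phi_rect t b L l hL) hD
    (((hint.const_mul (sin (π*b))).ofReal).const_mul (2 * Complex.I))
  rw [integral_const_mul, integral_complex_ofReal, integral_const_mul] at this
  have hsplit := intervalIntegral.integral_Iic_add_Ioi hint (tail_int t b l ht)
  rw [gamma_log t b ht hb] at hsplit
  have hiic : ∫ u in Iic l, Real.exp (-(t * Real.exp u) - b*u) = t^b * Real.Gamma (-b) -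
    ∫ u in Ioi l, Real.exp (-(t * Real.exp u) - b*u) := by linarith
  rw [hiic] at this
  have hrefl := Real.Gamma_mul_Gamma_one_sub (-b)
  have hsin : sin (π*b) < 0 := by
    have := sin_pos_of_pos_of_lt_pi (x := π*(-b)) (mul_pos pi_pos (by linarith)) (by nlinarith [pi_pos])
    rw [mul_neg, sin_neg] at this; linarith
  have hG : 0 < Real.Gamma (b+1) := Real.Gamma_pos_of_pos (by linarith)
  have hG2 : π / Real.Gamma (b+1) = - sin (π*b) * Real.Gamma (-b) := by
    rw [mul_neg, sin_neg, show 1 - -b = b+1 by ring] at hrefl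
    rw [div_eq_iff hG.ne', mul_assoc, hrefl]
    field_simp [hsin.ne]
  unfold Hank
  rw [show 2 * π * (t^b / Real.Gamma (b+1)) = 2 * t^b * (π / Real.Gamma (b+1)) by ring, hG2]
  have hI : Complex.I ≠ 0 := Complex.I_ne_zero
  apply mul_left_cancel₀ hI
  push_cast at this ⊢
  linear_combination this

theorem hank_zero (t l : ℝ) (ht : 0 < t) : Hank t 0 l := by
  have hconst : ∀ L ≤ l, DD (Phi t 0) L = DD (Phi t 0) l := by
    intro L hL
    have := Phi_rect t 0 L l hL
    simp only [mul_zero, Real.sin_zero, zero_mul, Complex.ofReal_zero, intervalIntegral.integral_zero, zero_add] at this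
    apply mul_left_cancel₀ Complex.I_ne_zero
    linear_combination -this
  have hlim : Tendsto (DD (Phi t 0)) atBot (𝓝 (∫ θ in (-π)..π, (1:ℂ))) := by
    apply intervalIntegral.tendsto_integral_filter_of_dominated_convergence (fun _ => Real.exp (t * 1))
    · refine Eventually.of_forall fun L => ?_
      exact ((Phi_diff t 0).continuous.comp (by fun_prop : Continuous fun θ : ℝ => (L + θ * Complex.I : ℂ))).aestronglyMeasurable
    · filter_upwards [eventually_le_atBot 0] with L hL
      refine ae_of_all _ fun θ _ => (Phi_DD_bound t 0 L ht θ).trans ?_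
      simp only [zero_mul, sub_zero]
      have := Real.exp_le_one_iff.2 hL
      gcongr
    · simp
    · refine ae_of_all _ fun θ _ => ?_
      have h0 : Tendsto (fun L : ℝ => Complex.exp (L + θ * Complex.I)) atBot (𝓝 0) := by
        rw [tendsto_zero_iff_norm_tendsto_zero]
        simp only [Complex.norm_exp]
        simpa using Real.tendsto_exp_atBot
      have hc : Continuous fun s : ℂ => Complex.exp (t * s) := by fun_prop
      have := (hc.tendsto 0).comp h0
      simpa [Phi, Function.comp_def] using this
  have : DD (Phi t 0) l = ∫ θ in (-π)..π, (1:ℂ) := by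
    refine tendsto_nhds_unique (Tendsto.congr' ?_ tendsto_const_nhds) hlim
    filter_upwards [eventually_le_atBot l] with L hL
    exact (hconst L hL).symm
  unfold Hank
  rw [this]
  simp; ring

theorem hank_succ (t b l : ℝ) (ht : 0 < t) (hb : -1 < b) (h : Hank t b l) : Hank t (b+1) l := by
  unfold Hank at *
  have hrel : ∀ w, (t * Complex.exp w - (b+1)) * Phi t (b+1) w = t * Phi t b w - (b+1) * Phi t (b+1) w := by
    intro w
    have : Phi t b w = Complex.exp w * Phi t (b+1) w := by
      unfold Phi
      rw [show (-(b*w):ℂ) = w + -(((b+1:ℝ):ℂ)*w) by push_cast; ring, Complex.exp_add]; ring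
    rw [this]; ring
  have hder : ∀ w, HasDerivAt (Phi t (b+1)) (t * Phi t b w - (b+1) * Phi t (b+1) w) w := by
    intro w
    rw [← hrel]
    have h1 : HasDerivAt (fun w : ℂ => Complex.exp (t * Complex.exp w)) _ w := ((Complex.hasDerivAt_exp w).const_mul (t:ℂ)).cexp
    have h2 : HasDerivAt (fun w : ℂ => Complex.exp (-(((b+1:ℝ):ℂ)*w)))
        (Complex.exp (-(((b+1:ℝ):ℂ)*w)) * -(((b+1:ℝ):ℂ)*1)) w :=
      (((hasDerivAt_id w).const_mul ((b+1:ℝ):ℂ)).neg).cexp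
    refine (h1.mul h2).congr_deriv ?_
    unfold Phi; push_cast; ring
  have hc : ∀ b, Continuous fun θ : ℝ => Phi t b (l + θ * Complex.I) := fun b =>
    (Phi_diff t b).continuous.comp (by fun_prop)
  have hftc := intervalIntegral.integral_eq_sub_of_hasDerivAt (a := -π) (b := π)
    (f := fun θ : ℝ => Phi t (b+1) (l + θ * Complex.I))
    (f' := fun θ : ℝ => (t * Phi t b (l + θ * Complex.I) - (b+1) * Phi t (b+1) (l + θ * Complex.I)) * Complex.I)
    (fun θ _ => by
      have h1 : HasDerivAt (fun θ : ℝ => (l + θ * Complex.I : ℂ)) Complex.I θ := by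
        simpa using ((Complex.ofRealCLM.hasDerivAt (x := θ)).mul_const Complex.I).const_add (l:ℂ)
      exact (hder _).comp θ h1)
    (by apply Continuous.intervalIntegrable; have := hc b; have := hc (b+1); fun_prop)
  rw [intervalIntegral.integral_mul_const, intervalIntegral.integral_sub, intervalIntegral.integral_const_mul,
    intervalIntegral.integral_const_mul] at hftc
  rotate_left
  · exact ((hc b).const_mul (t:ℂ)).intervalIntegrable _ _
  · exact ((hc (b+1)).const_mul (b+1:ℂ)).intervalIntegrable _ _
  have hj := Phi_jump t (b+1) l
  have hs : sin (π*(b+1)) = - sin (π*b) := by rw [mul_add, mul_one, sin_add_pi]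
  rw [hs] at hj
  have htail : t * (∫ u in Ioi l, Real.exp (-(t * Real.exp u) - b*u)) +
      (b+1) * (∫ u in Ioi l, Real.exp (-(t * Real.exp u) - (b+1)*u)) = Real.exp (-(t * Real.exp l) - (b+1)*l) := by
    have hd : ∀ u : ℝ, HasDerivAt (fun u => -Real.exp (-(t * Real.exp u) - (b+1)*u))
       (t * Real.exp (-(t * Real.exp u) - b*u) + (b+1) * Real.exp (-(t * Real.exp u) - (b+1)*u)) u := by
      intro u
      have h1 := ((((Real.hasDerivAt_exp u).const_mul t).neg.sub ((hasDerivAt_id u).const_mul (b+1))).exp).neg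
      refine h1.congr_deriv ?_
      have : Real.exp (-(t * Real.exp u) - b*u) = Real.exp u * Real.exp (-(t * Real.exp u) - (b+1)*u) := by
        rw [← Real.exp_add]; congr 1; ring
      rw [this]; simp; ring
    have hi := ((tail_int t b l ht).const_mul t).add ((tail_int t (b+1) l ht).const_mul (b+1))
    have h0 : Tendsto (fun u : ℝ => -Real.exp (-(t * Real.exp u) - (b+1)*u)) atTop (𝓝 0) := by
      rw [← neg_zero]
      apply Tendsto.neg
      apply squeeze_zero (fun _ => Real.exp_nonneg _) (g := fun u => Real.exp (-((b+1)*u)))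
      · intro u; apply Real.exp_le_exp.2
        have : 0 ≤ t * Real.exp u := by positivity
        linarith
      · apply Real.tendsto_exp_neg_atTop_nhds_zero.comp
        exact tendsto_id.const_mul_atTop (by linarith)
    have := integral_Ioi_of_hasDerivAt_of_tendsto (hd l).continuousAt.continuousWithinAt (fun u _ => hd u) hi h0
    rw [integral_add ((tail_int t b l ht).const_mul t) ((tail_int t (b+1) l ht).const_mul (b+1)),
      integral_const_mul, integral_const_mul] at this
    rw [this]; ring
  have hGam : Real.Gamma (b+1+1) = (b+1) * Real.Gamma (b+1) := Real.Gamma_add_one (by linarith)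
  have hb1 : b+1 ≠ 0 := by linarith
  have hG : 0 < Real.Gamma (b+1) := Real.Gamma_pos_of_pos (by linarith)
  have hb1' : (b+1 : ℂ) ≠ 0 := by exact_mod_cast hb1
  have hX : ((b+1 : ℝ):ℂ) * ((2 * π * (t^(b+1) / Real.Gamma (b+1+1)) +
      2 * sin (π*(b+1)) * ∫ u in Ioi l, Real.exp (-(t * Real.exp u) - (b+1)*u) : ℝ) : ℂ) =
     ((t * (2 * π * (t^b / Real.Gamma (b+1)) + 2 * sin (π*b) * ∫ u in Ioi l, Real.exp (-(t * Real.exp u) - b*u)) -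
      2 * sin (π*b) * Real.exp (-(t * Real.exp l) - (b+1)*l) : ℝ) : ℂ) := by
    rw [← Complex.ofReal_mul]
    congr 1
    rw [← htail, hs, hGam, Real.rpow_add_one ht.ne']
    field_simp
    ring
  apply mul_left_cancel₀ (a := ((b+1:ℝ):ℂ)) (by exact_mod_cast hb1)
  rw [hX]
  rw [Complex.ofReal_sub, Complex.ofReal_mul t, ← h]
  apply mul_left_cancel₀ Complex.I_ne_zero
  unfold DD
  push_cast at hftc hj ⊢
  simp only [neg_mul, ← sub_eq_add_neg] at hftc hj ⊢
  linear_combination -hftc + hj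

theorem hank (t b l : ℝ) (ht : 0 < t) (hb : -1 < b) : Hank t b l := by
  have key : ∀ n : ℕ, ∀ b : ℝ, -1 < b → b ≤ n → Hank t b l := by
    intro n
    induction n with
    | zero =>
      intro b hb hb0
      simp at hb0
      rcases hb0.lt_or_eq with h | h
      · exact hank_neg t b l ht h hb
      · rw [h]; exact hank_zero t l ht
    | succ k ih =>
      intro b hb hbk
      by_cases h : b ≤ 0
      · exact ih b hb (h.trans (by positivity))
      · push Not at h
        have := hank_succ t (b-1) l ht (by linarith) (ih (b-1) (by linarith) (by push_cast at hbk; linarith))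
        simpa using this
  obtain ⟨n, hn⟩ := exists_nat_ge b
  exact key n b hb hn

noncomputable def Psi (t α : ℝ) (w : ℂ) : ℂ :=
  Complex.exp (t * Complex.exp w) * Complex.exp (-w) / (1 + Complex.exp (-(α * w)))

noncomputable def PP (t : ℝ) (p w : ℂ) : ℂ :=
  Complex.exp (t * Complex.exp w) * Complex.exp w * (Complex.exp w - p)⁻¹

theorem DD_circle (H : ℂ → ℂ) (l : ℝ) :
    Complex.I * DD (fun w => H (Complex.exp w) * Complex.exp w) l = ∮ s in C(0, Real.exp l), H s := by
  unfold DD circleIntegral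
  have hper : Function.Periodic (fun θ : ℝ => H (Complex.exp (l + θ * Complex.I)) * Complex.exp (l + θ * Complex.I)) (2*π) := by
    intro θ
    have : Complex.exp (l + (θ + 2*π:ℝ) * Complex.I) = Complex.exp (l + θ * Complex.I) := by
      rw [← Complex.exp_periodic (l + θ * Complex.I)]; congr 1; push_cast; ring
    simp only [this]
  have h := hper.intervalIntegral_add_eq (-π) 0
  rw [show -π + 2*π = π by ring, zero_add] at h
  rw [h, ← intervalIntegral.integral_const_mul]
  congr 1; ext θ
  have : Complex.exp (l + θ * Complex.I) = circleMap 0 (Real.exp l) θ := by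
    rw [circleMap, zero_add, Complex.exp_add, Complex.ofReal_exp]
  rw [this, deriv_circleMap, smul_eq_mul]; ring

theorem DD_PP_out (t : ℝ) (p : ℂ) (hp : ‖p‖ = 1) : DD (PP t p) 1 = 2 * π * Complex.exp (t * p) := by
  have h := DD_circle (fun s => (s - p)⁻¹ • Complex.exp (t * s)) 1
  have hd : Differentiable ℂ (fun s : ℂ => Complex.exp (t * s)) := by fun_prop
  have h2 := (hd.diffContOnCl (s := Metric.ball 0 (Real.exp 1))).circleIntegral_sub_inv_smul (w := p)
    (by simp [hp])
  rw [h2] at h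
  have e : (fun w => (fun s => (s - p)⁻¹ • Complex.exp (t * s)) (Complex.exp w) * Complex.exp w) = PP t p := by
    ext w; simp [PP]; ring
  rw [e] at h
  apply mul_left_cancel₀ Complex.I_ne_zero
  rw [h, smul_eq_mul]; ring

theorem DD_PP_in (t L : ℝ) (p : ℂ) (hp : ‖p‖ = 1) (hL : L < 0) : DD (PP t p) L = 0 := by
  have h := DD_circle (fun s => (s - p)⁻¹ * Complex.exp (t * s)) L
  have hne : ∀ s : ℂ, s ∈ Metric.closedBall (0:ℂ) (Real.exp L) → s - p ≠ 0 := by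
    intro s hs h0
    rw [sub_eq_zero] at h0
    rw [h0] at hs
    simp [hp] at hs
    linarith
  have hd : ∀ s ∈ Metric.closedBall (0:ℂ) (Real.exp L), DifferentiableAt ℂ (fun s => (s - p)⁻¹ * Complex.exp (t * s)) s := by
    intro s hs
    have := hne s hs
    fun_prop (disch := assumption)
  have h2 := Complex.circleIntegral_eq_zero_of_differentiable_on_off_countable (c := 0) (R := Real.exp L)
    (Real.exp_nonneg _) (s := ∅) countable_empty
    (f := fun s => (s - p)⁻¹ * Complex.exp (t * s)) (fun s hs => (hd s hs).continuousAt.continuousWithinAt)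
    (fun s hs => hd s (Metric.ball_subset_closedBall hs.1))
  rw [h2] at h
  have e : (fun w => (fun s => (s - p)⁻¹ * Complex.exp (t * s)) (Complex.exp w) * Complex.exp w) = PP t p := by
    ext w; simp [PP]; ring
  rw [e] at h
  exact (mul_eq_zero.1 h).resolve_left Complex.I_ne_zero

theorem PP_jump (t u : ℝ) (p : ℂ) : PP t p (u - π * Complex.I) = PP t p (u + π * Complex.I) := by
  unfold PP; rw [exp_up, exp_dn]

theorem line_ne (l θ : ℝ) (p : ℂ) (hp : ‖p‖ = 1) (hl : l ≠ 0) : Complex.exp (l + θ * Complex.I) - p ≠ 0 := by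
  intro h
  rw [sub_eq_zero] at h
  have h1 : ‖Complex.exp (l + θ * Complex.I)‖ = 1 := by rw [h, hp]
  rw [Complex.norm_exp] at h1
  simp at h1
  exact hl h1

theorem PP_ii (t l : ℝ) (p : ℂ) (hp : ‖p‖ = 1) (hl : l ≠ 0) (a b : ℝ) :
    IntervalIntegrable (fun θ : ℝ => PP t p (l + θ * Complex.I)) volume a b := by
  apply Continuous.intervalIntegrable
  unfold PP
  refine Continuous.mul (by fun_prop) (Continuous.inv₀ (by fun_prop) fun θ => line_ne l θ p hp hl)

theorem Psi_line_ne (α l θ : ℝ) (hα : α ≠ 0) (hl : l ≠ 0) : 1 + Complex.exp (-(α * (l + θ * Complex.I))) ≠ 0 := by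
  have := line_ne (-(α*l)) (-(α*θ)) (-1) (by simp) (by simp [hα, hl])
  intro h; apply this
  rw [← h]; push_cast; ring_nf

theorem Psi_ii (t α l : ℝ) (hα : α ≠ 0) (hl : l ≠ 0) (a b : ℝ) :
    IntervalIntegrable (fun θ : ℝ => Psi t α (l + θ * Complex.I)) volume a b := by
  apply Continuous.intervalIntegrable
  unfold Psi
  exact Continuous.div (by fun_prop) (by fun_prop) fun θ => Psi_line_ne α l θ hα hl

theorem res_tendsto (N D : ℂ → ℂ) (c d : ℂ) (hN : ContinuousAt N c) (hD : HasDerivAt D d c) (h0 : D c = 0) (hd : d ≠ 0) :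
    Tendsto (fun w => (w - c) * (N w / D w)) (𝓝[≠] c) (𝓝 (N c / d)) := by
  have h1 := hD.tendsto_slope
  have h2 := (hN.tendsto.mono_left (nhdsWithin_le_nhds (s := {c}ᶜ))).mul (h1.inv₀ hd)
  rw [div_eq_mul_inv]
  refine h2.congr fun w => ?_
  simp only [slope, h0, vsub_eq_sub, smul_eq_mul, sub_zero]
  rw [mul_inv, inv_inv]; ring

theorem littleO_of_tendsto (f : ℂ → ℂ) (c : ℂ) (h : Tendsto (fun w => (w - c) * f w) (𝓝[≠] c) (𝓝 0)) :
    (fun z => f z - f c) =o[𝓝[≠] c] fun z => (z - c)⁻¹ := by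
  rw [Asymptotics.isLittleO_iff_tendsto']
  · have h1 : Tendsto (fun w : ℂ => (w - c) * f c) (𝓝[≠] c) (𝓝 0) := by
      have : Continuous fun w : ℂ => (w - c) * f c := by fun_prop
      have := this.tendsto c
      simp only [sub_self, zero_mul] at this
      exact this.mono_left nhdsWithin_le_nhds
    have := h.sub h1
    rw [sub_zero] at this
    refine this.congr fun w => ?_
    rw [div_inv_eq_mul]; ring
  · filter_upwards [self_mem_nhdsWithin] with w hw h0
    exact absurd (sub_eq_zero.1 (inv_eq_zero.1 h0)) hw

/-- Psi minus its polar parts -/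
noncomputable def QQ (t α : ℝ) (w0 w : ℂ) : ℂ :=
  Psi t α w - ((α:ℂ)⁻¹ * (Complex.exp w0)⁻¹ * PP t (Complex.exp w0) w +
    (α:ℂ)⁻¹ * (Complex.exp (-w0))⁻¹ * PP t (Complex.exp (-w0)) w)

theorem QQ_symm (t α : ℝ) (w0 w : ℂ) : QQ t α (-w0) w = QQ t α w0 w := by
  unfold QQ; rw [neg_neg]; ring

theorem QQ_res (t α : ℝ) (w0 : ℂ) (hα : α ≠ 0) (hw : Complex.exp (-(α * w0)) = -1)
    (hne : Complex.exp w0 ≠ Complex.exp (-w0)) :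
    Tendsto (fun w => (w - w0) * QQ t α w0 w) (𝓝[≠] w0) (𝓝 0) := by
  have hα' : (α:ℂ) ≠ 0 := by exact_mod_cast hα
  have h1 := res_tendsto (fun w => Complex.exp (t * Complex.exp w) * Complex.exp (-w))
    (fun w => 1 + Complex.exp (-(α * w))) w0 α (by fun_prop)
    (by
      have := (((hasDerivAt_id w0).const_mul (α:ℂ)).neg).cexp.const_add 1
      refine this.congr_deriv ?_
      simp [hw]) (by rw [hw]; ring) hα'
  have h2 := res_tendsto (fun w => Complex.exp (t * Complex.exp w) * Complex.exp w)
    (fun w => Complex.exp w - Complex.exp w0) w0 (Complex.exp w0) (by fun_prop)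
    ((Complex.hasDerivAt_exp w0).sub_const _) (by simp) (Complex.exp_ne_zero _)
  have h3 : Tendsto (fun w => (w - w0) * PP t (Complex.exp (-w0)) w) (𝓝[≠] w0) (𝓝 0) := by
    have hc : ContinuousAt (fun w => (w - w0) * PP t (Complex.exp (-w0)) w) w0 := by
      unfold PP
      have : Complex.exp w0 - Complex.exp (-w0) ≠ 0 := sub_ne_zero.2 hne
      fun_prop (disch := assumption)
    have := hc.tendsto
    simp only [sub_self, zero_mul] at this
    exact this.mono_left nhdsWithin_le_nhds
  have h4 := h1.sub ((h2.const_mul ((α:ℂ)⁻¹ * (Complex.exp w0)⁻¹)).add (h3.const_mul ((α:ℂ)⁻¹ * (Complex.exp (-w0))⁻¹)))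
  have hz : Complex.exp (t * Complex.exp w0) * Complex.exp (-w0) / (α:ℂ) -
     ((α:ℂ)⁻¹ * (Complex.exp w0)⁻¹ * (Complex.exp (t * Complex.exp w0) * Complex.exp w0 / Complex.exp w0) +
       (α:ℂ)⁻¹ * (Complex.exp (-w0))⁻¹ * 0) = 0 := by
    have := Complex.exp_ne_zero w0
    rw [Complex.exp_neg]; field_simp; ring
  rw [hz] at h4
  refine h4.congr fun w => ?_
  unfold QQ Psi PP
  ring

theorem removable2 (f : ℂ → ℂ) (U : Set ℂ) (hU : IsOpen U) (a b : ℂ) (hab : a ≠ b) (ha : a ∈ U) (hb : b ∈ U)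
    (hd : DifferentiableOn ℂ f (U \ {a, b}))
    (hfa : Tendsto (fun w => (w - a) * f w) (𝓝[≠] a) (𝓝 0))
    (hfb : Tendsto (fun w => (w - b) * f w) (𝓝[≠] b) (𝓝 0)) :
    ∃ g : ℂ → ℂ, DifferentiableOn ℂ g U ∧ ∀ w, w ≠ a → w ≠ b → g w = f w := by
  set f1 := Function.update f a (limUnder (𝓝[≠] a) f) with hf1
  have h1 : DifferentiableOn ℂ f1 (U \ {b}) := by
    apply Complex.differentiableOn_update_limUnder_of_isLittleO
    · exact (hU.sdiff isClosed_singleton).mem_nhds ⟨ha, hab⟩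
    · have e : (U \ {b}) \ {a} = U \ {a, b} := by
        ext w; simp only [mem_diff, mem_singleton_iff, mem_insert_iff]; tauto
      rw [e]; exact hd
    · exact littleO_of_tendsto f a hfa
  refine ⟨Function.update f1 b (limUnder (𝓝[≠] b) f1), ?_, ?_⟩
  · apply Complex.differentiableOn_update_limUnder_of_isLittleO (hU.mem_nhds hb) h1
    apply littleO_of_tendsto
    refine hfb.congr' ?_
    have : ∀ᶠ w in 𝓝[≠] b, w ≠ a := (eventually_ne_nhds hab.symm).filter_mono nhdsWithin_le_nhds
    filter_upwards [this] with w hw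
    rw [hf1, Function.update_of_ne hw]
  · intro w hwa hwb
    rw [Function.update_of_ne hwb, hf1, Function.update_of_ne hwa]

theorem int_aux1 (α : ℝ) (hα1 : 1 < α) (hα2 : α ≤ 4/3) (n : ℤ) (y : ℝ) (hy : |y| < π*(2 - 1/α))
    (h : -(α*y) = π + n * (2*π)) : y = π/α ∨ y = -(π/α) := by
  have hπ := pi_pos
  have hα0 : 0 < α := by linarith
  rw [abs_lt] at hy
  have e : α * (π*(2 - 1/α)) = π * (2*α-1) := by field_simp
  have h1 : α * y < π * (2*α-1) := by rw [← e]; gcongr; exact hy.2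
  have h2 : -(π * (2*α-1)) < α * y := by rw [← e, ← mul_neg]; gcongr; exact hy.1
  have hn1 : n < 1 := by
    by_contra hc; push Not at hc
    have : (1:ℝ) ≤ n := by exact_mod_cast hc
    nlinarith
  have hn2 : -2 < n := by
    by_contra hc; push Not at hc
    have : (n:ℝ) ≤ -2 := by exact_mod_cast hc
    nlinarith
  have : n = 0 ∨ n = -1 := by omega
  rcases this with rfl | rfl
  · right; field_simp; push_cast at h; linarith
  · left; field_simp; push_cast at h; linarith

theorem int_aux2 (α : ℝ) (hα1 : 1 < α) (n : ℤ) (y s : ℝ) (hs : s = 1 ∨ s = -1) (hy : |y| < π*(2 - 1/α))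
    (h : y = s * (π/α) + n * (2*π)) : y = s * (π/α) := by
  have hπ := pi_pos
  have hα0 : 0 < α := by linarith
  have hq : 0 < π/α := by positivity
  have e : π*(2 - 1/α) = 2*π - π/α := by ring
  rw [e, abs_lt] at hy
  have hn1 : n < 1 := by
    by_contra hc; push Not at hc
    have : (1:ℝ) ≤ n := by exact_mod_cast hc
    rcases hs with rfl | rfl <;> nlinarith [hy.1, hy.2]
  have hn2 : -1 < n := by
    by_contra hc; push Not at hc
    have : (n:ℝ) ≤ -1 := by exact_mod_cast hc
    rcases hs with rfl | rfl <;> nlinarith [hy.1, hy.2]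
  have : n = 0 := by omega
  subst this
  simpa using h

theorem exp_eq_aux (α : ℝ) (hα1 : 1 < α) (w : ℂ) (s : ℝ) (hs : s = 1 ∨ s = -1) (hw : |w.im| < π*(2 - 1/α))
    (h : Complex.exp w = Complex.exp (s * ((π/α:ℝ) * Complex.I))) : w = s * ((π/α:ℝ) * Complex.I) := by
  obtain ⟨n, hn⟩ := Complex.exp_eq_exp_iff_exists_int.1 h
  have hre := congrArg Complex.re hn
  have him := congrArg Complex.im hn
  simp at hre him
  have := int_aux2 α hα1 n w.im s hs hw (by rw [him])
  apply Complex.ext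
  · simp [hre]
  · simp [this]

theorem exp_eq_aux' (α : ℝ) (hα1 : 1 < α) (hα2 : α ≤ 4/3) (w : ℂ) (hw : |w.im| < π*(2 - 1/α))
    (h : 1 + Complex.exp (-(α * w)) = 0) : w = (π/α:ℝ) * Complex.I ∨ w = -((π/α:ℝ) * Complex.I) := by
  have h' : Complex.exp (-(α * w)) = Complex.exp (π * Complex.I) := by
    rw [Complex.exp_pi_mul_I]; linear_combination h
  obtain ⟨n, hn⟩ := Complex.exp_eq_exp_iff_exists_int.1 h'
  have hre := congrArg Complex.re hn
  have him := congrArg Complex.im hn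
  simp at hre him
  have hre : w.re = 0 := by rcases hre with h | h <;> linarith
  rcases int_aux1 α hα1 hα2 n w.im hw him with h | h
  · left; apply Complex.ext <;> simp [hre, h]
  · right; apply Complex.ext <;> simp [hre, h]

theorem QQ_rect (t α L : ℝ) (hα1 : 1 < α) (hα2 : α ≤ 4/3) (hL : L < 0) :
    (∫ u in L..1, (QQ t α ((π/α:ℝ) * Complex.I) (u - π * Complex.I) - QQ t α ((π/α:ℝ) * Complex.I) (u + π * Complex.I)))
      + Complex.I * DD (QQ t α ((π/α:ℝ) * Complex.I)) 1 - Complex.I * DD (QQ t α ((π/α:ℝ) * Complex.I)) L = 0 := by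
  have hπ := pi_pos
  have hα0 : 0 < α := by linarith
  set w0 : ℂ := (π/α:ℝ) * Complex.I with hw0
  set U : Set ℂ := {w | |w.im| < π*(2 - 1/α)} with hUdef
  have hU : IsOpen U := isOpen_lt (by fun_prop) continuous_const
  have hq : π/α < π := div_lt_self hπ hα1
  have hq0 : 0 < π/α := by positivity
  have hB : π*(2 - 1/α) = 2*π - π/α := by ring
  have h0U : w0 ∈ U := by
    simp only [hUdef, mem_setOf_eq, hw0, hB]
    simp only [Complex.re_ofReal_mul, Complex.im_ofReal_mul, Complex.I_im, mul_one]
    rw [abs_of_pos hq0]; linarith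
  have h1U : -w0 ∈ U := by
    simp only [hUdef, mem_setOf_eq, hw0, hB]
    simp only [Complex.neg_im, Complex.im_ofReal_mul, Complex.I_im, mul_one]
    rw [abs_neg, abs_of_pos hq0]; linarith
  have hne : w0 ≠ -w0 := by
    intro h
    have := congrArg Complex.im h
    simp only [hw0, Complex.neg_im, Complex.im_ofReal_mul, Complex.I_im, mul_one] at this
    linarith
  have hene : Complex.exp w0 ≠ Complex.exp (-w0) := by
    intro h
    have := exp_eq_aux α hα1 w0 (-1) (Or.inr rfl) h0U (by rw [h]; congr 1; rw [hw0]; push_cast; ring)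
    exact hne (this.trans (by rw [hw0]; push_cast; ring))
  have hexp : Complex.exp (-(α * w0)) = -1 := by
    have : -(α * w0) = -(π * Complex.I) := by
      rw [hw0]; push_cast
      have : (α:ℂ) ≠ 0 := by exact_mod_cast hα0.ne'
      field_simp
    rw [this, Complex.exp_neg, Complex.exp_pi_mul_I]; norm_num
  have hexp' : Complex.exp (-(α * (-w0))) = -1 := by
    have := hexp
    rw [Complex.exp_neg, inv_eq_iff_eq_inv] at this
    rw [mul_neg, neg_neg, this]; norm_num
  have hd : DifferentiableOn ℂ (QQ t α w0) (U \ {w0, -w0}) := by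
    intro w hw
    have hwU : w ∈ U := hw.1
    have hw1 : w ≠ w0 := fun h => hw.2 (by simp [h])
    have hw2 : w ≠ -w0 := fun h => hw.2 (by simp [h])
    have n1 : 1 + Complex.exp (-(α * w)) ≠ 0 := by
      intro h
      rcases exp_eq_aux' α hα1 hα2 w hwU h with h | h
      · exact hw1 h
      · exact hw2 h
    have n2 : Complex.exp w - Complex.exp w0 ≠ 0 := by
      intro h
      apply hw1
      have := exp_eq_aux α hα1 w 1 (Or.inl rfl) hwU (by rw [sub_eq_zero.1 h]; congr 1; rw [hw0]; push_cast; ring)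
      rw [this, hw0]; push_cast; ring
    have n3 : Complex.exp w - Complex.exp (-w0) ≠ 0 := by
      intro h
      apply hw2
      have := exp_eq_aux α hα1 w (-1) (Or.inr rfl) hwU (by rw [sub_eq_zero.1 h]; congr 1; rw [hw0]; push_cast; ring)
      rw [this, hw0]; push_cast; ring
    apply DifferentiableAt.differentiableWithinAt
    unfold QQ Psi PP
    fun_prop (disch := assumption)
  obtain ⟨g, hg, hgf⟩ := removable2 (QQ t α w0) U hU w0 (-w0) hne h0U h1U hd
    (QQ_res t α w0 hα0.ne' hexp hene)
    (by
      have := QQ_res t α (-w0) hα0.ne' hexp' (by rw [neg_neg]; exact hene.symm)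
      simpa only [QQ_symm] using this)
  have hsub : (uIcc L 1 ×ℂ uIcc (-π) π) ⊆ U := by
    intro w hw
    rw [Complex.mem_reProdIm, uIcc_of_le (by linarith : -π ≤ π)] at hw
    have : |w.im| ≤ π := abs_le.2 hw.2
    simp only [hUdef, mem_setOf_eq, hB]; linarith
  have hsub2 : (Ioo L 1 ×ℂ Ioo (-π) π) ⊆ U := by
    refine subset_trans ?_ hsub
    intro w hw
    rw [Complex.mem_reProdIm] at hw ⊢
    rw [uIcc_of_le (by linarith : -π ≤ π), uIcc_of_le (by linarith : L ≤ 1)]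
    exact ⟨Ioo_subset_Icc_self hw.1, Ioo_subset_Icc_self hw.2⟩
  have := rect_cont g L 1 (by linarith) (hg.continuousOn.mono hsub) (hg.mono hsub2)
  have him : ∀ w : ℂ, π/α < |w.im| → g w = QQ t α w0 w := by
    intro w hw
    apply hgf
    · rintro rfl
      simp only [hw0, Complex.im_ofReal_mul, Complex.I_im, mul_one, abs_of_pos hq0] at hw; linarith
    · rintro rfl
      simp only [hw0, Complex.neg_im, abs_neg, Complex.im_ofReal_mul, Complex.I_im, mul_one, abs_of_pos hq0] at hw; linarith
  have hre : ∀ w : ℂ, w.re ≠ 0 → g w = QQ t α w0 w := by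
    intro w hw
    apply hgf
    · rintro rfl; simp [hw0] at hw
    · rintro rfl; simp [hw0] at hw
  have hDD : ∀ l : ℝ, l ≠ 0 → DD g l = DD (QQ t α w0) l := by
    intro l hl
    unfold DD
    congr 1; ext θ
    exact hre _ (by simpa using hl)
  rw [hDD 1 one_ne_zero, hDD L hL.ne] at this
  rw [← this]
  congr 3
  funext u
  rw [him, him]
  · simpa [abs_of_pos hπ] using hq
  · simpa [abs_of_pos hπ] using hq

theorem norm_ew (x : ℝ) : ‖Complex.exp (x * Complex.I)‖ = 1 := Complex.norm_exp_ofReal_mul_I x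

theorem osc_eq (t α : ℝ) :
    (α:ℂ)⁻¹ * (Complex.exp ((π/α:ℝ) * Complex.I))⁻¹ * (2 * π * Complex.exp (t * Complex.exp ((π/α:ℝ) * Complex.I))) +
    (α:ℂ)⁻¹ * (Complex.exp (-((π/α:ℝ) * Complex.I)))⁻¹ * (2 * π * Complex.exp (t * Complex.exp (-((π/α:ℝ) * Complex.I))))
    = ((2 * π * osc α t : ℝ) : ℂ) := by
  generalize hx : π/α = x
  have e1 : ∀ y : ℝ, (Complex.exp (y * Complex.I))⁻¹ * Complex.exp (t * Complex.exp (y * Complex.I)) =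
      (Real.exp (t * cos y) : ℝ) * ((cos (t * sin y - y) : ℝ) + (sin (t * sin y - y):ℝ) * Complex.I) := by
    intro y
    rw [← Complex.exp_neg, ← Complex.exp_add]
    have : -(y * Complex.I) + t * Complex.exp (y * Complex.I) = (t * cos y : ℝ) + (t * sin y - y : ℝ) * Complex.I := by
      rw [Complex.exp_mul_I]; push_cast; ring
    rw [this, Complex.exp_add, Complex.exp_mul_I]; push_cast; ring
  have e2 := e1 x
  have e3 := e1 (-x)
  rw [cos_neg, sin_neg, show t * -sin x - -x = -(t * sin x - x) by ring, cos_neg, sin_neg] at e3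
  have e4 : (((-x:ℝ):ℂ) * Complex.I) = -(x * Complex.I) := by push_cast; ring
  rw [e4] at e3
  unfold osc
  rw [hx]
  push_cast at e2 e3 ⊢
  linear_combination (α:ℂ)⁻¹ * 2 * π * (e2 + e3)

theorem DD_QQ (t α l : ℝ) (hα : α ≠ 0) (hl : l ≠ 0) (x : ℝ) :
    DD (QQ t α (x * Complex.I)) l = DD (Psi t α) l -
      ((α:ℂ)⁻¹ * (Complex.exp (x * Complex.I))⁻¹ * DD (PP t (Complex.exp (x * Complex.I))) l +
    (α:ℂ)⁻¹ * (Complex.exp (-(x * Complex.I)))⁻¹ * DD (PP t (Complex.exp (-(x * Complex.I)))) l) := by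
  have h1 := norm_ew x
  have h2 : ‖Complex.exp (-(x * Complex.I))‖ = 1 := by
    rw [Complex.exp_neg, norm_inv, h1, inv_one]
  have i1 := PP_ii t l _ h1 hl (-π) π
  have i2 := PP_ii t l _ h2 hl (-π) π
  have i0 := Psi_ii t α l hα hl (-π) π
  unfold DD QQ
  rw [intervalIntegral.integral_sub i0 ((i1.const_mul _).add (i2.const_mul _)),
    intervalIntegral.integral_add (i1.const_mul _) (i2.const_mul _),
    intervalIntegral.integral_const_mul, intervalIntegral.integral_const_mul]

theorem Psi_rect (t α L : ℝ) (hα1 : 1 < α) (hα2 : α ≤ 4/3) (hL : L < 0) :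
    (∫ u in L..1, (Psi t α (u - π * Complex.I) - Psi t α (u + π * Complex.I)))
      + Complex.I * DD (Psi t α) 1 - Complex.I * DD (Psi t α) L = Complex.I * ((2 * π * osc α t : ℝ) : ℂ) := by
  have hα0 : α ≠ 0 := by linarith
  have h := QQ_rect t α L hα1 hα2 hL
  have h1 := norm_ew (π/α)
  have h2 : ‖Complex.exp (-(((π/α:ℝ):ℂ) * Complex.I))‖ = 1 := by
    rw [Complex.exp_neg, norm_inv, h1, inv_one]
  rw [DD_QQ t α 1 hα0 one_ne_zero, DD_QQ t α L hα0 hL.ne, DD_PP_out t _ h1, DD_PP_out t _ h2,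
    DD_PP_in t L _ h1 hL, DD_PP_in t L _ h2 hL, osc_eq] at h
  have hj : ∀ u : ℝ, QQ t α ((π/α:ℝ) * Complex.I) (u - π * Complex.I) - QQ t α ((π/α:ℝ) * Complex.I) (u + π * Complex.I)
     = Psi t α (u - π * Complex.I) - Psi t α (u + π * Complex.I) := by
    intro u
    unfold QQ
    rw [PP_jump, PP_jump]; ring
  simp only [hj] at h
  linear_combination h

theorem Psi_jump (t α u : ℝ) (hα1 : 1 < α) (hα2 : α ≤ 4/3) :
    Psi t α (u - π * Complex.I) - Psi t α (u + π * Complex.I) =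
      -(2 * π * Complex.I) * ((Real.exp (-(t * Real.exp u)) * kk α u : ℝ) : ℂ) := by
  have hk := kden_pos α u hα1 hα2
  unfold Psi
  rw [Complex.exp_neg (u - π * Complex.I), Complex.exp_neg (u + π * Complex.I), exp_up, exp_dn]
  have a1 : Complex.exp (-(α * (u - π * Complex.I))) = Real.exp (-(α*u)) * (cos (π*α) + sin (π*α) * Complex.I) := by
    rw [show -(α * (u - π * Complex.I)) = ((-(α*u):ℝ):ℂ) + ((π*α:ℝ):ℂ) * Complex.I by push_cast; ring, Complex.exp_add,
      Complex.exp_mul_I]; push_cast; ring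
  have a2 : Complex.exp (-(α * (u + π * Complex.I))) = Real.exp (-(α*u)) * (cos (π*α) - sin (π*α) * Complex.I) := by
    rw [show -(α * (u + π * Complex.I)) = ((-(α*u):ℝ):ℂ) + ((-(π*α):ℝ):ℂ) * Complex.I by push_cast; ring, Complex.exp_add,
      Complex.exp_mul_I]; push_cast; rw [Complex.cos_neg, Complex.sin_neg]; ring
  rw [a1, a2]
  have hs : Real.exp (-((1+α)*u)) = Real.exp (-(α*u)) * (Real.exp u)⁻¹ := by
    rw [← Real.exp_neg, ← Real.exp_add]; congr 1; ring
  have hE : Complex.exp (t * -(Real.exp u : ℂ)) = (Real.exp (-(t * Real.exp u)) : ℝ) := by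
    rw [Complex.ofReal_exp]; push_cast; rw [mul_neg]
  rw [hE]
  unfold kk
  rw [hs]
  generalize hq : Real.exp (-(α*u)) = q
  generalize Real.exp (-(t * Real.exp u)) = E
  have hS := sin_sq_add_cos_sq (π*α)
  have hkq : kden α u = 1 + 2 * q * cos (π*α) + q^2 := by unfold kden; rw [hq]
  generalize cos (π*α) = c at *
  generalize sin (π*α) = s at *
  have hk' : (kden α u : ℂ) ≠ 0 := by exact_mod_cast hk.ne'
  have hprod : (1 + (q:ℂ) * (c + s * Complex.I)) * (1 + (q:ℂ) * (c - s * Complex.I)) = kden α u := by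
    rw [hkq]; push_cast
    have : (s:ℂ)^2 + (c:ℂ)^2 = 1 := by exact_mod_cast hS
    linear_combination (q:ℂ)^2 * this - (q:ℂ)^2 * s^2 * Complex.I_sq
  have n1 : (1 + (q:ℂ) * (c + s * Complex.I)) ≠ 0 := fun h => hk' (by rw [← hprod, h, zero_mul])
  have n2 : (1 + (q:ℂ) * (c - s * Complex.I)) ≠ 0 := fun h => hk' (by rw [← hprod, h, mul_zero])
  have hu : (Real.exp u : ℂ) ≠ 0 := by exact_mod_cast (Real.exp_pos u).ne'
  have hπ : (π:ℂ) ≠ 0 := by exact_mod_cast pi_ne_zero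
  rw [← sub_eq_zero]
  push_cast [-Complex.ofReal_exp]
  rw [← hprod]
  generalize (Real.exp u : ℂ) = X at *
  generalize hd1 : (1 + (q:ℂ) * (c + s * Complex.I)) = d1 at *
  generalize hd2 : (1 + (q:ℂ) * (c - s * Complex.I)) = d2 at *
  have hdd : d1 - d2 = 2 * q * s * Complex.I := by rw [← hd1, ← hd2]; ring
  field_simp
  linear_combination (E:ℂ) * hdd

theorem Psi_lim (t α : ℝ) (ht : 0 < t) (hα1 : 1 < α) : Tendsto (DD (Psi t α)) atBot (𝓝 0) := by
  have hb : ∀ᶠ L in atBot, ‖DD (Psi t α) L‖ ≤ Real.exp (t * Real.exp L + (α-1) * L) * 2 * |π - (-π)| := by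
    filter_upwards [eventually_le_atBot (-1)] with L hL
    refine intervalIntegral.norm_integral_le_of_norm_le_const (fun θ _ => ?_)
    unfold Psi
    have h1 := Phi_DD_bound t 1 L ht θ
    unfold Phi at h1
    rw [Complex.ofReal_one, one_mul] at h1
    rw [norm_div]
    have h2 : ‖Complex.exp (-(α * (L + θ * Complex.I)))‖ = Real.exp (-(α*L)) := by
      rw [Complex.norm_exp]; simp
    have h3 : Real.exp (-(α*L)) / 2 ≤ ‖1 + Complex.exp (-(α * (L + θ * Complex.I)))‖ := by
      have := norm_sub_le_norm_add (Complex.exp (-(α * (L + θ * Complex.I)))) 1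
      rw [h2, norm_one, add_comm] at this
      have h4 : 2 ≤ Real.exp (-(α*L)) := by
        have := Real.add_one_le_exp (-(α*L)); nlinarith
      linarith
    have h5 := Real.exp_pos (-(α*L))
    calc _ ≤ Real.exp (t * Real.exp L - 1 * L) / (Real.exp (-(α*L)) / 2) := by gcongr
      _ = _ := by
        rw [div_div_eq_mul_div, mul_div_right_comm, ← Real.exp_sub]; congr 2; ring
  refine squeeze_zero_norm' hb ?_
  rw [show (0:ℝ) = 0 * 2 * |π - (-π)| by simp]
  apply Tendsto.mul_const
  apply Tendsto.mul_const
  apply Real.tendsto_exp_atBot.comp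
  have h1 : Tendsto (fun l' : ℝ => t * Real.exp l') atBot (𝓝 (t*0)) := Real.tendsto_exp_atBot.const_mul t
  have h2 : Tendsto (fun l' : ℝ => (α-1) * l') atBot atBot := tendsto_id.const_mul_atBot (by linarith)
  exact h1.add_atBot h2

theorem Psi_one (t α : ℝ) (ht : 0 < t) (hα1 : 1 < α) (hα2 : α ≤ 4/3) :
    DD (Psi t α) 1 = ((2 * π * osc α t + 2 * π * ∫ u in Iic 1, Real.exp (-(t * Real.exp u)) * kk α u : ℝ) : ℂ) := by
  have hint : IntegrableOn (fun u => Real.exp (-(t * Real.exp u)) * kk α u) (Iic 1) :=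
    (kk_int_t α t hα1 hα2 ht.le).integrableOn
  have := shift_limit (Psi t α) (fun u => -(2 * π * Complex.I) * ((Real.exp (-(t * Real.exp u)) * kk α u : ℝ) : ℂ))
    1 (Complex.I * ((2 * π * osc α t : ℝ) : ℂ)) 0 (by
      filter_upwards [eventually_lt_atBot 0] with L hL
      have := Psi_rect t α L hα1 hα2 hL
      simpa only [Psi_jump t α _ hα1 hα2] using this) (Psi_lim t α ht hα1)
    (hint.ofReal.const_mul _)
  rw [integral_const_mul, integral_complex_ofReal] at this
  apply mul_left_cancel₀ Complex.I_ne_zero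
  push_cast at this ⊢
  linear_combination this

theorem Phi_sum (t α : ℝ) (ht : 0 < t) (hα1 : 1 < α) :
    HasSum (fun k : ℕ => (-1)^k * DD (Phi t (α*k+1)) 1) (DD (Psi t α) 1) := by
  have h := intervalIntegral.hasSum_integral_of_dominated_convergence (a := -π) (b := π) (μ := volume)
    (F := fun (k:ℕ) (θ:ℝ) => (-1)^k * Phi t (α*k+1) ((1:ℝ) + θ * Complex.I))
    (f := fun θ : ℝ => Psi t α ((1:ℝ) + θ * Complex.I))
    (fun k _ => Real.exp (t * Real.exp 1 - 1) * (Real.exp (-α))^k) ?_ ?_ ?_ ?_ ?_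
  · simp only [intervalIntegral.integral_const_mul] at h
    exact h
  · intro k
    have : Continuous fun θ : ℝ => Phi t (α*k+1) ((1:ℝ) + θ * Complex.I) :=
      (Phi_diff t _).continuous.comp (by fun_prop)
    exact (continuous_const.mul this).aestronglyMeasurable
  · intro k
    refine ae_of_all _ fun θ _ => ?_
    rw [norm_mul, norm_pow, norm_neg, norm_one, one_pow, one_mul]
    refine (Phi_DD_bound t _ 1 ht θ).trans (le_of_eq ?_)
    rw [← Real.exp_nat_mul, ← Real.exp_add]; congr 1; ring
  · refine ae_of_all _ fun θ _ => ?_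
    exact (summable_geometric_of_lt_one (Real.exp_nonneg _) (Real.exp_lt_one_iff.2 (by linarith))).mul_left _
  · simp
  · refine ae_of_all _ fun θ _ => ?_
    set w : ℂ := (1:ℝ) + θ * Complex.I with hw
    have hn : ‖-Complex.exp (-(α * w))‖ < 1 := by
      rw [norm_neg, Complex.norm_exp]
      apply Real.exp_lt_one_iff.2
      simp [hw]; linarith
    have := (hasSum_geometric_of_norm_lt_one hn).mul_left (Complex.exp (t * Complex.exp w) * Complex.exp (-w))
    rw [sub_neg_eq_add, ← div_eq_mul_inv] at this
    refine (Eq.mpr (congrArg (fun f => HasSum f _) (funext fun k => ?_)) this)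
    unfold Phi
    rw [neg_pow (Complex.exp _), ← Complex.exp_nat_mul,
      show (-((α*k+1 : ℝ) * w) : ℂ) = -w + k * -(α * w) by push_cast; ring, Complex.exp_add (-w)]
    ring

theorem sin_sum (q x : ℝ) (hq0 : 0 ≤ q) (hq : q < 1) :
    HasSum (fun k : ℕ => (-1)^k * q^k * sin (x*k)) (-(q * sin x) / (1 + 2*q*cos x + q^2)) := by
  set z : ℂ := -(q * Complex.exp (x * Complex.I)) with hz
  have hn : ‖z‖ < 1 := by
    rw [hz, norm_neg, norm_mul, norm_ew, mul_one, Complex.norm_real, Real.norm_of_nonneg hq0]; exact hq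
  have h := Complex.hasSum_im (hasSum_geometric_of_norm_lt_one hn)
  convert h using 1
  · ext k
    have : z^k = (((-1)^k * q^k : ℝ):ℂ) * (cos (x*k) + sin (x*k) * Complex.I) := by
      rw [hz, neg_pow, mul_pow, ← Complex.exp_nat_mul, show (k:ℂ) * (x * Complex.I) = ((x*k:ℝ):ℂ) * Complex.I by push_cast; ring,
        Complex.exp_mul_I]
      push_cast; ring
    rw [this, Complex.im_ofReal_mul]
    simp [-Complex.ofReal_mul, -Complex.ofReal_cos, -Complex.ofReal_sin]
  · have h1 : (1 - z) = ((1 + q * cos x : ℝ):ℂ) + ((q * sin x : ℝ):ℂ) * Complex.I := by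
      rw [hz, Complex.exp_mul_I]; push_cast; ring
    rw [Complex.inv_im, h1, Complex.normSq_add_mul_I]
    congr 1
    · simp [-Complex.ofReal_mul, -Complex.ofReal_cos, -Complex.ofReal_sin]
    · nlinarith [sin_sq_add_cos_sq x]

theorem tail_sum (t α : ℝ) (ht : 0 < t) (hα1 : 1 < α) (hα2 : α ≤ 4/3) :
    HasSum (fun k : ℕ => (-1)^k * (-2 * sin (π*(α*k+1)) * ∫ u in Ioi 1, Real.exp (-(t * Real.exp u) - (α*k+1)*u)))
      (2 * π * ∫ u in Ioi 1, Real.exp (-(t * Real.exp u)) * kk α u) := by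
  have h := hasSum_integral_of_dominated_convergence (μ := volume.restrict (Ioi 1))
    (F := fun (k:ℕ) (u:ℝ) => ((-1)^k * (-2 * sin (π*(α*k+1)))) * Real.exp (-(t * Real.exp u) - (α*k+1)*u))
    (f := fun u : ℝ => (2*π) * (Real.exp (-(t * Real.exp u)) * kk α u))
    (fun k u => (2 * Real.exp (-u)) * (Real.exp (-α))^k) ?_ ?_ ?_ ?_ ?_
  · simp only [integral_const_mul] at h
    simpa only [mul_assoc] using h
  · intro k; fun_prop
  · intro k
    filter_upwards [ae_restrict_mem measurableSet_Ioi] with u hu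
    have hu : 1 < u := hu
    rw [norm_mul, norm_mul, norm_pow, norm_neg, norm_one, one_pow, one_mul, Real.norm_of_nonneg (Real.exp_nonneg _), mul_assoc]
    apply mul_le_mul
    · rw [norm_mul]
      have := abs_sin_le_one (π*(α*k+1))
      simp; linarith
    · rw [← Real.exp_nat_mul, ← Real.exp_add]
      apply Real.exp_le_exp.2
      have h1 : 0 ≤ t * Real.exp u := by positivity
      have h2 : 0 ≤ α * k * (u - 1) := mul_nonneg (by positivity) (by linarith)
      linarith
    · positivity
    · norm_num
  · refine ae_of_all _ fun u => ?_
    exact (summable_geometric_of_lt_one (Real.exp_nonneg _) (Real.exp_lt_one_iff.2 (by linarith))).mul_left _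
  · simp only [tsum_mul_left]
    have : IntegrableOn (fun u : ℝ => Real.exp (-u)) (Ioi 1) := integrableOn_exp_neg_Ioi 1
    exact (this.const_mul 2).mul_const _
  · filter_upwards [ae_restrict_mem measurableSet_Ioi] with u hu
    have hu : 1 < u := hu
    have hq : Real.exp (-(α*u)) < 1 := Real.exp_lt_one_iff.2 (by nlinarith)
    have := (sin_sum (Real.exp (-(α*u))) (π*α) (Real.exp_nonneg _) hq).mul_left
      (2 * (Real.exp (-(t * Real.exp u)) * Real.exp (-u)))
    have e2 : (2*π) * (Real.exp (-(t * Real.exp u)) * kk α u) =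
        2 * (Real.exp (-(t * Real.exp u)) * Real.exp (-u)) * (-(Real.exp (-(α*u)) * sin (π*α)) /
          (1 + 2 * Real.exp (-(α*u)) * cos (π*α) + Real.exp (-(α*u))^2)) := by
      have hs : Real.exp (-((1+α)*u)) = Real.exp (-u) * Real.exp (-(α*u)) := by
        rw [← Real.exp_add]; congr 1; ring
      have hk : kden α u = 1 + 2 * Real.exp (-(α*u)) * cos (π*α) + Real.exp (-(α*u))^2 := rfl
      rw [← hk, kk, hs]
      have := pi_ne_zero
      field_simp
    rw [e2]
    refine (Eq.mpr (congrArg (fun f => HasSum f _) (funext fun k => ?_)) this)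
    have hs : sin (π*(α*k+1)) = - sin (π*α*k) := by
      rw [mul_add, mul_one, sin_add_pi, mul_assoc]
    have he : Real.exp (-(t * Real.exp u) - (α*k+1)*u) = Real.exp (-(t * Real.exp u)) * Real.exp (-u) * Real.exp (-(α*u))^k := by
      rw [← Real.exp_nat_mul, ← Real.exp_add, ← Real.exp_add]; congr 1; ring
    rw [hs, he]; ring

theorem ml_repr_s10 (α t : ℝ) (hα1 : 1 < α) (hα2 : α ≤ 4/3) (ht : 0 < t) :
    t * mittagLeffler α 2 (-(t^α)) = gg α t + osc α t := by
  have h1 := Phi_sum t α ht hα1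
  rw [Psi_one t α ht hα1 hα2] at h1
  have h2 := Complex.hasSum_re h1
  have h3 := h2.add (tail_sum t α ht hα1 hα2)
  have hterm : ∀ k : ℕ, ((-1)^k * DD (Phi t (α*k+1)) 1).re +
      (-1)^k * (-2 * sin (π*(α*k+1)) * ∫ u in Ioi 1, Real.exp (-(t * Real.exp u) - (α*k+1)*u)) =
      (2 * π * t) * ((-(t^α))^k / Real.Gamma (α*k+2)) := by
    intro k
    have hk : (0:ℝ) ≤ α * k := by positivity
    have := hank t (α*k+1) 1 ht (by linarith)
    unfold Hank at this
    rw [this, show ((-1:ℂ)^k) = (((-1)^k:ℝ):ℂ) by push_cast; ring, Complex.re_ofReal_mul, Complex.ofReal_re,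
      neg_pow (t^α), ← Real.rpow_mul_natCast ht.le, Real.rpow_add_one ht.ne', show α*k+1+1 = α*k+2 by ring]
    ring
  simp only [hterm, Complex.ofReal_re] at h3
  have h4 := h3.tsum_eq
  rw [tsum_mul_left] at h4
  have hint := kk_int_t α t hα1 hα2 ht.le
  have hsplit := intervalIntegral.integral_Iic_add_Ioi (b := 1) hint.integrableOn hint.integrableOn
  have hg : gg α t = ∫ u, Real.exp (-(t * Real.exp u)) * kk α u := rfl
  rw [hg, ← hsplit]
  unfold mittagLeffler
  have h2π : 2 * π ≠ 0 := by positivity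
  apply mul_left_cancel₀ h2π
  linear_combination h4


theorem ml_near_zero (α x : ℝ) (hα1 : 1 < α) (hx : 0 ≤ x) (hx2 : x ≤ 1/2) :
    |mittagLeffler α 2 (-x) - 1| ≤ 2 * x := by
  have hG : ∀ k : ℕ, 1 ≤ Real.Gamma (α * k + 2) := by
    intro k
    have : Real.Gamma 2 = 1 := Real.Gamma_two
    rw [← this]
    apply Real.Gamma_strictMonoOn_Ici.monotoneOn (by simp) (by simp; positivity)
    have : 0 ≤ α * k := by positivity
    linarith
  have hb : ∀ k : ℕ, ‖(-x)^k / Real.Gamma (α * k + 2)‖ ≤ x^k := by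
    intro k
    rw [norm_div, norm_pow, norm_neg, Real.norm_of_nonneg hx, Real.norm_of_nonneg (by linarith [hG k])]
    exact div_le_self (by positivity) (hG k)
  have hgs : Summable (fun k : ℕ => x^k) := summable_geometric_of_lt_one hx (by linarith)
  have hs : Summable (fun k : ℕ => (-x)^k / Real.Gamma (α * k + 2)) := hgs.of_norm_bounded hb
  unfold mittagLeffler
  rw [hs.tsum_eq_zero_add]
  simp only [pow_zero, Nat.cast_zero, mul_zero, zero_add, Real.Gamma_two, div_one, add_sub_cancel_left]
  rw [← Real.norm_eq_abs]
  have hsh : HasSum (fun k : ℕ => x * x^k) (x * (1-x)⁻¹) := (hasSum_geometric_of_lt_one hx (by linarith)).mul_left x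
  refine (tsum_of_norm_bounded hsh (fun k => ?_)).trans ?_
  · have := hb (k+1); rw [pow_succ'] at this ⊢
    simpa [pow_succ'] using this
  · have : (1-x)⁻¹ ≤ 2 := by
      rw [inv_le_comm₀ (by linarith) (by norm_num)]; linarith
    nlinarith

theorem ml_tendsto (α : ℝ) (hα1 : 1 < α) :
    Tendsto (fun t : ℝ => mittagLeffler α 2 (-(t^α))) (𝓝[>] 0) (𝓝 1) := by
  have h0 : Tendsto (fun t : ℝ => t^α) (𝓝[>] 0) (𝓝 0) := by
    have := (Real.continuousAt_rpow_const 0 α (Or.inr (by linarith))).tendsto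
    rw [Real.zero_rpow (by linarith)] at this
    exact this.mono_left nhdsWithin_le_nhds
  rw [tendsto_iff_norm_sub_tendsto_zero]
  refine squeeze_zero' (Eventually.of_forall fun _ => norm_nonneg _) ?_ (by simpa using h0.const_mul 2)
  have hlt : ∀ᶠ t : ℝ in 𝓝[>] 0, t^α < 1/2 := h0.eventually_lt_const (by norm_num)
  filter_upwards [hlt, self_mem_nhdsWithin] with t ht ht0
  exact ml_near_zero α _ hα1 (Real.rpow_nonneg (le_of_lt ht0) _) ht.le

theorem gg_tendsto (α : ℝ) (hα1 : 1 < α) (hα2 : α ≤ 4/3) :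
    Tendsto (gg α) (𝓝[>] 0) (𝓝 (∫ u, kk α u)) := by
  have hk := kk_cont α hα1 hα2
  apply tendsto_integral_filter_of_dominated_convergence (kk α)
  · exact Eventually.of_forall fun t => by fun_prop
  · filter_upwards [self_mem_nhdsWithin] with t ht
    refine ae_of_all _ fun u => ?_
    have := kk_nonneg α u hα1 hα2
    rw [Real.norm_of_nonneg (by positivity)]
    have : Real.exp (-(t * Real.exp u)) ≤ 1 := by
      have ht : 0 < t := ht
      rw [Real.exp_le_one_iff]; have : 0 ≤ t * Real.exp u := by positivity
      linarith
    nlinarith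
  · exact kk_int α hα1 hα2
  · refine ae_of_all _ fun u => ?_
    have : Continuous fun t : ℝ => Real.exp (-(t * Real.exp u)) * kk α u := by fun_prop
    have := this.tendsto 0
    simp at this
    exact this.mono_left nhdsWithin_le_nhds

theorem gg_deriv_tendsto (α : ℝ) (hα1 : 1 < α) (hα2 : α ≤ 4/3) :
    Tendsto (fun t => t⁻¹ * ((∫ u, kk α u) - gg α t)) (𝓝[>] 0) (𝓝 (∫ u, Real.exp u * kk α u)) := by
  have hk := kk_cont α hα1 hα2
  have e : (fun t => ∫ u, t⁻¹ * (1 - Real.exp (-(t * Real.exp u))) * kk α u) =ᶠ[𝓝[>] 0]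
      (fun t => t⁻¹ * ((∫ u, kk α u) - gg α t)) := by
    filter_upwards [self_mem_nhdsWithin] with t ht
    have ht : 0 < t := ht
    unfold gg
    rw [← integral_sub (kk_int α hα1 hα2) (kk_int_t α t hα1 hα2 ht.le), ← integral_const_mul]
    congr 1; ext u; ring
  refine Tendsto.congr' e ?_
  apply tendsto_integral_filter_of_dominated_convergence (fun u => Real.exp u * kk α u)
  · exact Eventually.of_forall fun t => by fun_prop
  · filter_upwards [self_mem_nhdsWithin] with t ht
    have ht : 0 < t := ht
    refine ae_of_all _ fun u => ?_
    have := kk_nonneg α u hα1 hα2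
    have h1 : Real.exp (-(t * Real.exp u)) ≤ 1 := by
      rw [Real.exp_le_one_iff]; have : 0 ≤ t * Real.exp u := by positivity
      linarith
    have h2 := Real.add_one_le_exp (-(t * Real.exp u))
    rw [Real.norm_of_nonneg (mul_nonneg (mul_nonneg (by positivity) (by linarith)) this)]
    gcongr
    rw [inv_mul_le_iff₀ ht]; linarith
  · exact kk_int' α hα1 hα2
  · refine ae_of_all _ fun u => ?_
    apply Tendsto.mul_const
    have hd : HasDerivAt (fun t : ℝ => -Real.exp (-(t * Real.exp u))) (Real.exp u) 0 := by
      have := (((hasDerivAt_id (0:ℝ)).mul_const (Real.exp u)).neg.exp).neg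
      refine this.congr_deriv ?_
      simp
    have := hd.tendsto_slope_zero_right
    refine this.congr fun t => ?_
    simp; left; ring

theorem osc_deriv (α : ℝ) : HasDerivAt (osc α) (2/α) 0 := by
  have h1 : HasDerivAt (fun t : ℝ => Real.exp (t * cos (π/α))) (cos (π/α)) 0 := by
    refine (((hasDerivAt_id (0:ℝ)).mul_const (cos (π/α))).exp).congr_deriv ?_
    simp
  have h2 : HasDerivAt (fun t : ℝ => cos (t * sin (π/α) - π/α)) (sin (π/α)^2) 0 := by
    refine ((((hasDerivAt_id (0:ℝ)).mul_const (sin (π/α))).sub_const (π/α)).cos).congr_deriv ?_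
    simp; ring
  refine ((h1.mul h2).const_mul (2/α)).congr_deriv ?_
  simp
  rw [show cos (π/α) * cos (π/α) + sin (π/α)^2 = 1 by nlinarith [sin_sq_add_cos_sq (π/α)], mul_one]

theorem osc_zero (α : ℝ) : osc α 0 = 2/α * cos (π/α) := by simp [osc]

theorem kk_mom0 (α : ℝ) (hα1 : 1 < α) (hα2 : α ≤ 4/3) : ∫ u, kk α u = -(2/α * cos (π/α)) := by
  have h1 := (gg_tendsto α hα1 hα2).add ((osc_deriv α).continuousAt.tendsto.mono_left (nhdsWithin_le_nhds (s := Ioi 0)))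
  have hid : Tendsto (fun t : ℝ => t) (𝓝[>] 0) (𝓝 0) := nhdsWithin_le_nhds
  have h2 := hid.mul (ml_tendsto α hα1)
  have h3 : (fun t : ℝ => t * mittagLeffler α 2 (-(t^α))) =ᶠ[𝓝[>] 0] fun t => gg α t + osc α t := by
    filter_upwards [self_mem_nhdsWithin] with t ht
    exact ml_repr_s10 α t hα1 hα2 ht
  have := tendsto_nhds_unique h1 (h2.congr' h3)
  rw [osc_zero] at this
  linarith

theorem kk_mom1 (α : ℝ) (hα1 : 1 < α) (hα2 : α ≤ 4/3) : ∫ u, Real.exp u * kk α u = 2/α - 1 := by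
  have h1 := (osc_deriv α).tendsto_slope_zero_right.sub (ml_tendsto α hα1)
  refine tendsto_nhds_unique (gg_deriv_tendsto α hα1 hα2) (h1.congr' ?_)
  filter_upwards [self_mem_nhdsWithin] with t ht
  have ht : 0 < t := ht
  have := ml_repr_s10 α t hα1 hα2 ht
  have h4 : gg α t = t * mittagLeffler α 2 (-(t^α)) - osc α t := by linarith
  rw [h4, kk_mom0 α hα1 hα2, zero_add, osc_zero, smul_eq_mul]
  field_simp
  ring

theorem cos_neg_aux (α : ℝ) (hα1 : 1 < α) (hα2 : α ≤ 4/3) : cos (π/α) < 0 := by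
  have hπ := pi_pos
  apply cos_neg_of_pi_div_two_lt_of_lt
  · rw [div_lt_div_iff₀ (by norm_num) (by linarith)]; nlinarith
  · rw [div_lt_iff₀ (by linarith)]; nlinarith

theorem gg_ge (α t : ℝ) (hα1 : 1 < α) (hα2 : α ≤ 4/3) (ht : 0 ≤ t) :
    2/α * (Real.exp (-((1-α/2)/(-cos (π/α)) * t)) * (-cos (π/α))) ≤ gg α t := by
  set m := (1-α/2)/(-cos (π/α)) with hm
  have hc := cos_neg_aux α hα1 hα2
  have h0 := kk_mom0 α hα1 hα2
  have h1 := kk_mom1 α hα1 hα2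
  have hi : Integrable (fun u => Real.exp (-(m*t)) * ((1 + t*m) * kk α u - t * (Real.exp u * kk α u))) :=
    (((kk_int α hα1 hα2).const_mul _).sub ((kk_int' α hα1 hα2).const_mul t)).const_mul _
  have : ∫ u, Real.exp (-(m*t)) * ((1 + t*m) * kk α u - t * (Real.exp u * kk α u)) ≤ gg α t := by
    unfold gg
    apply integral_mono hi (kk_int_t α t hα1 hα2 ht)
    intro u
    have hk := kk_nonneg α u hα1 hα2
    have : Real.exp (-(m*t)) * (1 + t*m - t * Real.exp u) ≤ Real.exp (-(t * Real.exp u)) := by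
      have := Real.add_one_le_exp (m*t - t * Real.exp u)
      calc Real.exp (-(m*t)) * (1 + t*m - t * Real.exp u) ≤ Real.exp (-(m*t)) * Real.exp (m*t - t * Real.exp u) := by
            gcongr; linarith
        _ = _ := by rw [← Real.exp_add]; congr 1; ring
    calc _ = (Real.exp (-(m*t)) * (1 + t*m - t * Real.exp u)) * kk α u := by ring
      _ ≤ _ := mul_le_mul_of_nonneg_right this hk
  refine le_trans (le_of_eq ?_) this
  rw [integral_const_mul, integral_sub ((kk_int α hα1 hα2).const_mul _) ((kk_int' α hα1 hα2).const_mul t),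
    integral_const_mul, integral_const_mul, h0, h1, hm]
  have hα0 : α ≠ 0 := by linarith
  have := hc.ne
  field_simp
  ring

theorem ml_ge_gg (α t : ℝ) (hα1 : 1 < α) (hα2 : α ≤ 4/3) (ht : 1 ≤ t) :
    (1 - Real.exp (-(1/100))) * gg α t ≤ t * mittagLeffler α 2 (-(t^α)) := by
  rw [ml_repr_s10 α t hα1 hα2 (by linarith)]
  have h1 := osc_bound α t hα1 hα2 ht
  have h2 := gg_ge α t hα1 hα2 (by linarith)
  have h3 : -osc α t ≤ Real.exp (-(1/100)) * gg α t := by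
    have : (0:ℝ) ≤ 2/α := by have : 0 < α := by linarith
                             positivity
    calc -osc α t = 2/α * (-(Real.exp (t * cos (π/α)) * cos (t * sin (π/α) - π/α))) := by unfold osc; ring
      _ ≤ 2/α * (Real.exp (-(1/100)) * (Real.exp (-((1-α/2)/(-cos (π/α)) * t)) * (-cos (π/α)))) := by gcongr
      _ = Real.exp (-(1/100)) * (2/α * (Real.exp (-((1-α/2)/(-cos (π/α)) * t)) * (-cos (π/α)))) := by ring
      _ ≤ _ := by gcongr
  linarith

theorem gg_lower (α : ℝ) (hα1 : 1 < α) (hα2 : α ≤ 4/3) :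
    ∃ c, 0 < c ∧ ∀ t : ℝ, 1 ≤ t → c ≤ t^(α-1) * gg α t := by
  have hs := sin_neg_aux α hα1 hα2
  have hC : 0 < -sin (π*α)/π := div_pos (by linarith) pi_pos
  refine ⟨Real.exp (-1) * ((-sin (π*α)/π) * (Real.exp (-(α-1)) / 4)), by positivity, fun t ht => ?_⟩
  have ht0 : 0 < t := by linarith
  set L := Real.log t with hL
  have hL0 : 0 ≤ L := Real.log_nonneg ht
  have hte : Real.exp L = t := Real.exp_log ht0
  have htp : t^(α-1) = Real.exp (L*(α-1)) := Real.rpow_def_of_pos ht0 _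
  have hlow : ∀ u ∈ Icc (-L-1) (-L), Real.exp (-1) * ((-sin (π*α)/π) * (Real.exp ((α-1)*(-L-1)) / 4)) ≤
      Real.exp (-(t * Real.exp u)) * kk α u := by
    intro u hu
    apply mul_le_mul
    · apply Real.exp_le_exp.2
      have : t * Real.exp u ≤ 1 := by
        rw [← hte, ← Real.exp_add, Real.exp_le_one_iff]; linarith [hu.2]
      linarith
    · unfold kk
      rw [mul_div_assoc]
      apply mul_le_mul_of_nonneg_left _ hC.le
      have hd := kden_pos α u hα1 hα2
      have hx : 1 ≤ Real.exp (-(α*u)) := by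
        rw [Real.one_le_exp_iff]; nlinarith [hu.2]
      rw [div_le_div_iff₀ (by norm_num) hd]
      have hd4 : kden α u ≤ 4 * Real.exp (-(α*u))^2 := by
        unfold kden; nlinarith [cos_le_one (π*α)]
      calc Real.exp ((α-1)*(-L-1)) * kden α u ≤ Real.exp ((α-1)*u) * (4 * Real.exp (-(α*u))^2) := by
            apply mul_le_mul _ hd4 hd.le (Real.exp_nonneg _)
            apply Real.exp_le_exp.2
            exact mul_le_mul_of_nonneg_left hu.1 (by linarith)
        _ = _ := by
          rw [← Real.exp_nat_mul]
          rw [show Real.exp (-((1+α)*u)) = Real.exp ((α-1)*u) * Real.exp ((2:ℕ)*(-(α*u))) by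
            rw [← Real.exp_add]; congr 1; push_cast; ring]
          ring
    · positivity
    · positivity
  have hint := kk_int_t α t hα1 hα2 ht0.le
  have h1 : Real.exp (-1) * ((-sin (π*α)/π) * (Real.exp ((α-1)*(-L-1)) / 4)) ≤ gg α t := by
    have h2 : ∫ u in Icc (-L-1) (-L), Real.exp (-(t * Real.exp u)) * kk α u ≤ gg α t := by
      unfold gg
      apply setIntegral_le_integral hint
      exact ae_of_all _ fun u => mul_nonneg (Real.exp_nonneg _) (kk_nonneg α u hα1 hα2)
    refine le_trans ?_ h2
    have h3 := setIntegral_mono_on (μ := volume) (s := Icc (-L-1) (-L)) (integrableOn_const (by simp)) hint.integrableOn measurableSet_Icc hlow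
    simpa using h3
  calc _ = Real.exp (L*(α-1)) * (Real.exp (-1) * ((-sin (π*α)/π) * (Real.exp ((α-1)*(-L-1)) / 4))) := by
        rw [show (α-1)*(-L-1) = -(L*(α-1)) + -(α-1) by ring, Real.exp_add, Real.exp_neg (L*(α-1))]
        have := (Real.exp_pos (L*(α-1))).ne'
        field_simp
    _ ≤ _ := by rw [htp]; gcongr

theorem ml_lower (α : ℝ) (hα1 : 1 < α) (hα2 : α ≤ 4/3) :
    ∃ c, 0 < c ∧ ∀ x : ℝ, 1 ≤ x → c ≤ x * mittagLeffler α 2 (-x) := by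
  obtain ⟨c, hc, h⟩ := gg_lower α hα1 hα2
  have hq : 0 < 1 - Real.exp (-(1/100)) := by
    have : Real.exp (-(1/100)) < 1 := by rw [Real.exp_lt_one_iff]; norm_num
    linarith
  refine ⟨(1 - Real.exp (-(1/100))) * c, by positivity, fun x hx => ?_⟩
  have hx0 : 0 < x := by linarith
  set t := x^(1/α) with ht
  have ht1 : 1 ≤ t := Real.one_le_rpow hx (by have : 0 < α := by linarith
                                              positivity)
  have ht0 : 0 < t := by linarith
  have htx : t^α = x := by
    rw [ht, ← Real.rpow_mul hx0.le, one_div_mul_cancel (by linarith), Real.rpow_one]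
  have h1 := ml_ge_gg α t hα1 hα2 ht1
  rw [htx] at h1
  have h2 := h t ht1
  have h3 : x = t^(α-1) * t := by
    rw [← htx, ← Real.rpow_add_one ht0.ne']; ring_nf
  have h4 : x * mittagLeffler α 2 (-x) = t^(α-1) * (t * mittagLeffler α 2 (-x)) := by
    rw [← mul_assoc, ← h3]
  rw [h4]
  calc _ ≤ (1 - Real.exp (-(1/100))) * (t^(α-1) * gg α t) := by gcongr
    _ = t^(α-1) * ((1 - Real.exp (-(1/100))) * gg α t) := by ring
    _ ≤ _ := by gcongr

/-- backward-stability estimate (Theorem 3.1, case `α ∈ (1,4/3]`) in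
Fourier coefficients: there is `C > 0` depending only on `α` such that for every
`T > 0`, every nondecreasing positive sequence `λ` with `λ_0 T^α ≥ 1`, and every
sequence `a`, if `b_n = T E_{α,2}(−λ_n T^α) a_n` and `∑ λ_n^{2−2γ} b_n²` converges,
then `∑ λ_n^{−2γ} a_n²` converges and is `≤ C T^{2(α−1)} ∑ λ_n^{2−2γ} b_n²`. -/
theorem backward_stability (α γ : ℝ) (hα1 : 1 < α) (hα2 : α ≤ 4 / 3) :
    ∃ C : ℝ, 0 < C ∧ ∀ T : ℝ, 0 < T →
      ∀ lam : ℕ → ℝ, Monotone lam → (∀ n, 0 < lam n) → 1 ≤ lam 0 * T ^ α →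
      ∀ a : ℕ → ℝ,
      (Summable fun n =>
          lam n ^ (2 - 2 * γ) * (T * mittagLeffler α 2 (-(lam n * T ^ α)) * a n) ^ 2) →
      Summable (fun n => lam n ^ (-(2 * γ)) * a n ^ 2) ∧
      (∑' n, lam n ^ (-(2 * γ)) * a n ^ 2) ≤
        C * T ^ (2 * (α - 1)) *
          ∑' n, lam n ^ (2 - 2 * γ) * (T * mittagLeffler α 2 (-(lam n * T ^ α)) * a n) ^ 2 := by
  obtain ⟨c, hc, h⟩ := ml_lower α hα1 hα2
  refine ⟨(c^2)⁻¹, by positivity, fun T hT lam hmono hpos h1 a hs => ?_⟩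
  have key : ∀ n, lam n ^ (-(2 * γ)) * a n ^ 2 ≤ (c^2)⁻¹ * T ^ (2 * (α - 1)) *
      (lam n ^ (2 - 2 * γ) * (T * mittagLeffler α 2 (-(lam n * T ^ α)) * a n) ^ 2) := by
    intro n
    have hl := hpos n
    have hTα : 0 < T^α := Real.rpow_pos_of_pos hT _
    have hx : 1 ≤ lam n * T^α := h1.trans (by gcongr; exact hmono (Nat.zero_le n))
    have hE := h _ hx
    set E := mittagLeffler α 2 (-(lam n * T ^ α)) with hEdef
    have e1 : lam n ^ (2 - 2 * γ) = lam n ^ (-(2*γ)) * lam n^2 := by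
      rw [← Real.rpow_natCast (lam n) 2, ← Real.rpow_add hl]; congr 1; push_cast; ring
    have e2 : T ^ (2 * (α - 1)) * T^2 = (T^α)^2 := by
      rw [← Real.rpow_natCast T 2, ← Real.rpow_add hT, ← Real.rpow_natCast (T^α) 2, ← Real.rpow_mul hT.le]
      congr 1; push_cast; ring
    have e3 : (c^2)⁻¹ * T ^ (2 * (α - 1)) * (lam n ^ (2 - 2 * γ) * (T * E * a n) ^ 2)
        = (c^2)⁻¹ * (lam n * T^α * E)^2 * (lam n ^ (-(2*γ)) * a n^2) := by
      rw [e1]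
      calc _ = (c^2)⁻¹ * (T ^ (2 * (α - 1)) * T^2) * (lam n^2 * E^2) * (lam n ^ (-(2*γ)) * a n^2) := by ring
        _ = _ := by rw [e2]; ring
    rw [e3]
    have e4 : 1 ≤ (c^2)⁻¹ * (lam n * T^α * E)^2 := by
      rw [inv_mul_eq_div, one_le_div (by positivity)]
      gcongr
    have e5 : 0 ≤ lam n ^ (-(2*γ)) * a n^2 := by positivity
    nlinarith
  have hsum : Summable (fun n => lam n ^ (-(2 * γ)) * a n ^ 2) :=
    Summable.of_nonneg_of_le (fun n => by have := hpos n; positivity) key (hs.mul_left _)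
  refine ⟨hsum, ?_⟩
  rw [← tsum_mul_left]
  exact hsum.tsum_le_tsum key (hs.mul_left _)
end
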